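/- Let n ≥ 1, 0 < λ < n+1, κ, θ > 0 with κθ ≥ 1, and let α, β ∈ ℝ satisfy α < 1/(θ+1), β < 1/(κ+1), α+β ≥ 0, λ+2α > 0, λ+2β > 0, κ ≤ (2(n+1)−λ−2β)/(λ+2β), θ ≤ (2(n+1)−λ−2α)/(λ+2α), and 1/(θ+1) + 1/(κ+1) > (α+β+λ)/(n+1). Then there is no pair of positive continuous functions u, v on the closed half space ℝ^n × [0,∞) with ∫_{ℝ^{n+1}_+} u^{θ+1} < ∞ satisfying u(x,t) = t^{−α} ∫_{ℝ^{n+1}_+} v(y,z)^κ z^{−β} |(x,t)−(y,z)|^{−λ} dy dz and v(y,z) = z^{−β} ∫_{ℝ^{n+1}_+} u(x,t)^θ t^{−α} |(x,t)−(y,z)|^{−λ} dx dt for all points of the open half space ℝ^{n+1}_+. -/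

import Mathlib

open MeasureTheory ENNReal

noncomputable section

/-- The upper half space `ℝ^{n+1}_+ = {(x,t) : t > 0}`. -/
def upperHalf (n : ℕ) : Set (EuclideanSpace ℝ (Fin n) × ℝ) := {X | 0 < X.2}

/-- The Euclidean distance `|(x,t)-(y,z)|` on `ℝ^n × ℝ`. -/
def hsDist {n : ℕ} (X Y : EuclideanSpace ℝ (Fin n) × ℝ) : ℝ :=
  Real.sqrt (‖X.1 - Y.1‖ ^ 2 + (X.2 - Y.2) ^ 2)

namespace HS

abbrev EE (n : ℕ) := EuclideanSpace ℝ (Fin n) × ℝ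

variable {n : ℕ}

instance instHaar : (volume : Measure (EE n)).IsAddHaarMeasure :=
  inferInstanceAs (((volume : Measure (EuclideanSpace ℝ (Fin n))).prod
    (volume : Measure ℝ)).IsAddHaarMeasure)

def dd (Z : EE n) : ℝ := Real.sqrt (‖Z.1‖ ^ 2 + Z.2 ^ 2)

def ev (s : ℝ) : EE n := (0, s)

def kk (lam : ℝ) (Z : EE n) : ℝ := dd Z ^ (-lam)

def qq (a L : ℝ) : EE n → ℝ := (Metric.ball (0 : EE n) L).indicator (fun Z => ‖Z‖ ^ (-a))

lemma dd_nonneg (Z : EE n) : 0 ≤ dd Z := Real.sqrt_nonneg _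

lemma norm_le_dd (Z : EE n) : ‖Z‖ ≤ dd Z := by
  rw [Prod.norm_def]
  apply max_le
  · exact Real.le_sqrt_of_sq_le (by nlinarith [sq_nonneg Z.2])
  · apply Real.le_sqrt_of_sq_le
    rw [Real.norm_eq_abs, sq_abs]; nlinarith [sq_nonneg ‖Z.1‖]

lemma dd_pos {Z : EE n} (h : Z ≠ 0) : 0 < dd Z :=
  lt_of_lt_of_le (norm_pos_iff.2 h) (norm_le_dd Z)

lemma dd_neg (Z : EE n) : dd (-Z) = dd Z := by simp [dd]

lemma dd_cont : Continuous (dd : EE n → ℝ) := by unfold dd; fun_prop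

lemma dd_eq (Z : EE n) : dd Z = ‖WithLp.toLp 2 Z‖ := by
  rw [WithLp.prod_norm_eq_of_L2]; simp [dd]

lemma dd_ev (Z : EE n) (s : ℝ) : |dd (Z + ev s) - dd Z| ≤ |s| := by
  have h : dd (ev s : EE n) = |s| := by simp [dd, ev, Real.sqrt_sq_eq_abs]
  rw [← h, dd_eq, dd_eq, dd_eq]
  refine (abs_norm_sub_norm_le _ _).trans ?_
  rw [← WithLp.toLp_sub]; simp

lemma kk_nonneg (lam : ℝ) (Z : EE n) : 0 ≤ kk lam Z := Real.rpow_nonneg (dd_nonneg Z) _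

lemma kk_neg (lam : ℝ) (Z : EE n) : kk lam (-Z) = kk lam Z := by simp [kk, dd_neg]

lemma kk_sub (lam : ℝ) (X Y : EE n) : kk lam (X - Y) = kk lam (Y - X) := by
  rw [← kk_neg, neg_sub]

lemma kk_meas (lam : ℝ) : Measurable (kk lam : EE n → ℝ) :=
  (dd_cont.measurable).pow_const _

lemma one_sub_rpow_le {lam r : ℝ} (hl : 0 < lam) (h0 : 0 < r) (h1 : r ≤ 1) :
    1 - r ^ lam ≤ max 1 lam * (1 - r) := by
  rcases le_total 1 lam with h | h
  · have := one_add_mul_self_le_rpow_one_add (s := r - 1) (by linarith) h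
    rw [max_eq_right h]
    have e : 1 + (r - 1) = r := by ring
    rw [e] at this; linarith
  · rw [max_eq_left h]
    have : r ^ (1 : ℝ) ≤ r ^ lam := Real.rpow_le_rpow_of_exponent_ge h0 h1 h
    rw [Real.rpow_one] at this; linarith

lemma ker_lip_aux {lam a b : ℝ} (hl : 0 < lam) (ha : 0 < a) (hab : a ≤ b) :
    b * (a ^ (-lam) - b ^ (-lam)) ≤ max 1 lam * (b - a) * a ^ (-lam) := by
  have hb : 0 < b := ha.trans_le hab
  have h := one_sub_rpow_le hl (div_pos ha hb) ((div_le_one hb).2 hab)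
  have e : b ^ (-lam) = a ^ (-lam) * (a / b) ^ lam := by
    rw [Real.div_rpow ha.le hb.le, Real.rpow_neg ha.le, Real.rpow_neg hb.le]
    have := (Real.rpow_pos_of_pos ha lam).ne'
    field_simp
  have hp : 0 < a ^ (-lam) := Real.rpow_pos_of_pos ha _
  calc b * (a ^ (-lam) - b ^ (-lam)) = a ^ (-lam) * b * (1 - (a / b) ^ lam) := by rw [e]; ring
    _ ≤ a ^ (-lam) * b * (max 1 lam * (1 - a / b)) := by gcongr
    _ = max 1 lam * (b - a) * a ^ (-lam) := by field_simp

lemma ker_lip {lam a b : ℝ} (hl : 0 < lam) (ha : 0 < a) (hb : 0 < b) :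
    a * |a ^ (-lam) - b ^ (-lam)| ≤ max 1 lam * |a - b| * (a ^ (-lam) + b ^ (-lam)) := by
  have hp : 0 < a ^ (-lam) := Real.rpow_pos_of_pos ha _
  have hq : 0 < b ^ (-lam) := Real.rpow_pos_of_pos hb _
  have hL : 0 < max 1 lam := by positivity
  rcases le_total a b with h | h
  · have h1 := ker_lip_aux hl ha h
    have h2 : b ^ (-lam) ≤ a ^ (-lam) := Real.rpow_le_rpow_of_nonpos ha h (by linarith)
    rw [abs_of_nonneg (by linarith), abs_of_nonpos (by linarith)]
    have h3 : a * (a ^ (-lam) - b ^ (-lam)) ≤ b * (a ^ (-lam) - b ^ (-lam)) :=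
      mul_le_mul_of_nonneg_right h (by linarith)
    have h4 : 0 ≤ max 1 lam * (b - a) * b ^ (-lam) :=
      mul_nonneg (mul_nonneg hL.le (by linarith)) hq.le
    nlinarith
  · have h1 := ker_lip_aux hl hb h
    have h2 : a ^ (-lam) ≤ b ^ (-lam) := Real.rpow_le_rpow_of_nonpos hb h (by linarith)
    rw [abs_of_nonpos (by linarith), abs_of_nonneg (by linarith)]
    have h4 : 0 ≤ max 1 lam * (a - b) * a ^ (-lam) :=
      mul_nonneg (mul_nonneg hL.le (by linarith)) hp.le
    nlinarith

lemma qq_nonneg (a L : ℝ) (Z : EE n) : 0 ≤ qq a L Z :=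
  Set.indicator_nonneg (fun _ _ => Real.rpow_nonneg (norm_nonneg _) _) _

lemma qq_meas (a L : ℝ) : Measurable (qq a L : EE n → ℝ) :=
  (measurable_norm.pow_const _).indicator measurableSet_ball

lemma qq_int {a L : ℝ} (ha : a < (n : ℝ) + 1) : Integrable (qq a L : EE n → ℝ) := by
  unfold qq
  rw [integrable_indicator_iff measurableSet_ball]
  rw [integrableOn_fun_norm_addHaar (volume : Measure (EE n)) (f := fun y => y ^ (-a))]
  have hd : Module.finrank ℝ (EE n) = n + 1 := by simp [EE]
  rw [hd]
  have h := (intervalIntegral.intervalIntegrable_rpow' (a := 0) (b := max L 0) (r := (n : ℝ) - a) (by linarith)).1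
  refine (h.mono_set (s := Set.Ioo 0 L) ?_).congr_fun ?_ measurableSet_Ioo
  · intro y hy; exact ⟨hy.1, hy.2.le.trans (le_max_left _ _)⟩
  · intro y hy
    simp only [Nat.add_sub_cancel, smul_eq_mul]
    rw [← Real.rpow_natCast, ← Real.rpow_add hy.1]; rfl

def Hold (w : EE n → ℝ) (γ : ℝ) : Prop :=
  ∀ R τ : ℝ, 0 < τ → ∃ M : ℝ, 0 ≤ M ∧ ∀ s : ℝ, 0 < s → s ≤ 1 → ∀ X : EE n, ‖X‖ ≤ R → τ ≤ X.2 →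
    |w (X + ev s) - w X| ≤ M * s ^ γ

lemma isCompact_box (R : ℝ) : IsCompact {X : EE n | ‖X‖ ≤ R ∧ 0 ≤ X.2} := by
  have h : {X : EE n | ‖X‖ ≤ R ∧ 0 ≤ X.2} = Metric.closedBall 0 R ∩ {X | 0 ≤ X.2} := by
    ext X; simp
  rw [h]
  exact (isCompact_closedBall _ _).inter_right (isClosed_le continuous_const continuous_snd)

lemma exists_upper {u : EE n → ℝ} (hu : ContinuousOn u {X | 0 ≤ X.2}) (R : ℝ) :
    ∃ M, 0 < M ∧ ∀ X : EE n, ‖X‖ ≤ R → 0 ≤ X.2 → |u X| ≤ M := by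
  obtain ⟨C, hC⟩ := (isCompact_box (n := n) R).exists_bound_of_continuousOn
    (hu.mono (fun X hX => hX.2))
  exact ⟨max C 1, by positivity, fun X h1 h2 => (hC X ⟨h1, h2⟩).trans (le_max_left _ _)⟩

lemma exists_lower {u : EE n → ℝ} (hu : ContinuousOn u {X | 0 ≤ X.2})
    (hpos : ∀ X : EE n, 0 ≤ X.2 → 0 < u X) (R : ℝ) :
    ∃ m, 0 < m ∧ ∀ X : EE n, ‖X‖ ≤ R → 0 ≤ X.2 → m ≤ u X := by
  rcases Set.eq_empty_or_nonempty {X : EE n | ‖X‖ ≤ R ∧ 0 ≤ X.2} with h | h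
  · refine ⟨1, one_pos, fun X h1 h2 => ?_⟩
    have : X ∈ {X : EE n | ‖X‖ ≤ R ∧ 0 ≤ X.2} := ⟨h1, h2⟩
    rw [h] at this; exact this.elim
  · obtain ⟨X0, hX0, hm⟩ := (isCompact_box (n := n) R).exists_isMinOn h
      (hu.mono (fun X hX => hX.2))
    exact ⟨u X0, hpos _ hX0.2, fun X h1 h2 => hm ⟨h1, h2⟩⟩

lemma norm_ev (s : ℝ) : ‖(ev s : EE n)‖ = |s| := by simp [ev, Prod.norm_def]

lemma norm_add_ev {X : EE n} {R s : ℝ} (hs : 0 < s) (hs1 : s ≤ 1) (hX : ‖X‖ ≤ R) :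
    ‖X + ev s‖ ≤ R + 1 := by
  refine (norm_add_le _ _).trans ?_
  rw [norm_ev, abs_of_pos hs]; linarith

lemma ev_snd (X : EE n) (s : ℝ) : (X + ev s).2 = X.2 + s := rfl

lemma rpow_lip {m M κ : ℝ} (hm : 0 < m) (hmM : m ≤ M) :
    ∃ C, 0 ≤ C ∧ ∀ a b, m ≤ a → a ≤ M → m ≤ b → b ≤ M → |a ^ κ - b ^ κ| ≤ C * |a - b| := by
  have hc : ContinuousOn (fun x : ℝ => κ * x ^ (κ - 1)) (Set.Icc m M) := by
    apply ContinuousOn.mul continuousOn_const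
    intro x hx
    exact (Real.continuousAt_rpow_const _ _ (Or.inl (by linarith [hx.1]))).continuousWithinAt
  obtain ⟨C, hC⟩ := isCompact_Icc.exists_bound_of_continuousOn hc
  refine ⟨C, (norm_nonneg _).trans (hC m ⟨le_rfl, hmM⟩), fun a b h1 h2 h3 h4 => ?_⟩
  have := (convex_Icc m M).norm_image_sub_le_of_norm_hasDerivWithin_le (f := fun x : ℝ => x ^ κ)
    (f' := fun x : ℝ => κ * x ^ (κ - 1)) (C := C)
    (fun x hx => (Real.hasDerivAt_rpow_const (Or.inl (by linarith [hx.1]))).hasDerivWithinAt)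
    hC ⟨h3, h4⟩ ⟨h1, h2⟩
  simpa using this

lemma hold_rpow {v : EE n → ℝ} {κ γ : ℝ} (hv : ContinuousOn v {X | 0 ≤ X.2})
    (hpos : ∀ X : EE n, 0 ≤ X.2 → 0 < v X) (h : Hold v γ) : Hold (fun X => v X ^ κ) γ := by
  intro R τ hτ
  obtain ⟨M0, hM0, hM⟩ := h R τ hτ
  obtain ⟨M1, _, hM1⟩ := exists_upper hv (R + 1)
  obtain ⟨m, hm0, hm⟩ := exists_lower hv hpos (R + 1)
  obtain ⟨C, hC0, hC⟩ := rpow_lip (κ := κ) hm0 (le_max_left m M1)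
  refine ⟨C * M0, by positivity, fun s hs hs1 X hX hXτ => ?_⟩
  have n1 := norm_add_ev hs hs1 hX
  have p1 : 0 ≤ (X + ev s).2 := by rw [ev_snd]; linarith
  have n2 : ‖X‖ ≤ R + 1 := by linarith
  have p2 : 0 ≤ X.2 := by linarith
  calc _ ≤ C * |v (X + ev s) - v X| := hC _ _ (hm _ n1 p1)
          ((le_abs_self _).trans ((hM1 _ n1 p1).trans (le_max_right _ _))) (hm _ n2 p2)
          ((le_abs_self _).trans ((hM1 _ n2 p2).trans (le_max_right _ _)))
    _ ≤ C * (M0 * s ^ γ) := by gcongr; exact hM s hs hs1 X hX hXτ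
    _ = _ := by ring

lemma ae_ne_sub (X : EE n) : ∀ᵐ Y : EE n, X - Y ≠ 0 := by
  have : ∀ᵐ Y : EE n, Y ≠ X := by
    rw [ae_iff]; simp
  filter_upwards [this] with Y hY h
  exact hY (sub_eq_zero.1 h).symm

lemma hold_conv {lam σ γ : ℝ} (hl : 0 < lam) (hσ : 0 < σ) (hσl : lam + σ < (n : ℝ) + 1)
    {u F : EE n → ℝ} (hF0 : ∀ Y, 0 ≤ F Y) (hFm : Measurable F)
    (hu : ContinuousOn u {X | 0 ≤ X.2})
    (hint : ∀ X : EE n, 0 < X.2 → Integrable (fun Y => F Y * kk lam (X - Y)))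
    (heq : ∀ X : EE n, 0 < X.2 → u X = ∫ Y, F Y * kk lam (X - Y))
    (hF : Hold F γ) : Hold u (min (γ + σ / 4) (3 / 4)) := by
  intro R τ hτ
  obtain ⟨M, hM0, hM⟩ := hF (R + 1) (τ / 2) (by linarith)
  obtain ⟨M', hM'0, hM'⟩ := exists_upper hu (R + 1)
  set c := min (τ / 2) 1 with hc
  have hc0 : 0 < c := by positivity
  set J := ∫ Z : EE n, qq (lam + σ) 1 Z with hJ
  have hJ0 : 0 ≤ J := integral_nonneg (qq_nonneg _ _)
  set Λ := max 1 lam with hΛ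
  have hΛ0 : 0 < Λ := by positivity
  refine ⟨M * c ^ σ * J + Λ / c * (2 * M'), by positivity, fun s hs hs1 X hX hXτ => ?_⟩
  set r := c * s ^ (1 / 4 : ℝ) with hr
  have hs4 : s ^ (1 / 4 : ℝ) ≤ 1 := Real.rpow_le_one hs.le hs1 (by norm_num)
  have hr0 : 0 < r := by positivity
  have hrc : r ≤ c := by
    calc r ≤ c * 1 := by rw [hr]; gcongr
      _ = c := mul_one c
  have hr1 : r ≤ 1 := hrc.trans (min_le_right _ _)
  have hrτ : r ≤ τ / 2 := hrc.trans (min_le_left _ _)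
  set k2 : EE n → ℝ := fun Z => (max (dd Z) r) ^ (-lam) with hk2
  set k1 : EE n → ℝ := fun Z => kk lam Z - k2 Z with hk1
  have hk2m : Measurable k2 := (dd_cont.measurable.max measurable_const).pow_const _
  have hk20 : ∀ Z, 0 ≤ k2 Z := fun Z => Real.rpow_nonneg (le_trans hr0.le (le_max_right _ _)) _
  have hk2le : ∀ Z : EE n, Z ≠ 0 → k2 Z ≤ kk lam Z := fun Z hZ =>
    Real.rpow_le_rpow_of_nonpos (dd_pos hZ) (le_max_left _ _) (by linarith)
  have hX0 : 0 < X.2 := by linarith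
  have hXs0 : 0 < (X + ev s).2 := by rw [ev_snd]; linarith
  have i2 : ∀ X : EE n, 0 < X.2 → Integrable (fun Y => F Y * k2 (X - Y)) := by
    intro X hX
    refine (hint X hX).mono' (hFm.mul (hk2m.comp (measurable_const.sub measurable_id))).aestronglyMeasurable ?_
    filter_upwards [ae_ne_sub X] with Y hY
    rw [Real.norm_of_nonneg (mul_nonneg (hF0 _) (hk20 _))]
    exact mul_le_mul_of_nonneg_left (hk2le _ hY) (hF0 _)
  have i1 : ∀ X : EE n, 0 < X.2 → Integrable (fun Y => F Y * k1 (X - Y)) := by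
    intro X hX
    refine ((hint X hX).sub (i2 X hX)).congr ?_
    filter_upwards with Y
    simp only [hk1, Pi.sub_apply]; ring
  have split : ∀ X : EE n, 0 < X.2 → u X = (∫ Y, F Y * k1 (X - Y)) + ∫ Y, F Y * k2 (X - Y) := by
    intro X hX
    rw [← integral_add (i1 X hX) (i2 X hX), heq X hX]
    congr 1; ext Y; simp only [hk1]; ring
  have tr : ∫ Y, F Y * k1 (X + ev s - Y) = ∫ Y, F (Y + ev s) * k1 (X - Y) := by
    rw [← integral_add_right_eq_self (fun Y => F Y * k1 (X + ev s - Y)) (ev s)]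
    congr 1; ext Y; rw [add_sub_add_right_eq_sub]
  have itr : Integrable (fun Y => F (Y + ev s) * k1 (X - Y)) := by
    have := (i1 _ hXs0).comp_add_right (ev s)
    refine this.congr ?_
    filter_upwards with Y
    rw [add_sub_add_right_eq_sub]
  have key : u (X + ev s) - u X = (∫ Y, (F (Y + ev s) - F Y) * k1 (X - Y)) +
      ∫ Y, F Y * (k2 (X + ev s - Y) - k2 (X - Y)) := by
    rw [split _ hXs0, split _ hX0, tr]
    have e1 : ∫ Y, (F (Y + ev s) - F Y) * k1 (X - Y) =
        (∫ Y, F (Y + ev s) * k1 (X - Y)) - ∫ Y, F Y * k1 (X - Y) := by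
      rw [← integral_sub itr (i1 _ hX0)]; congr 1; ext Y; ring
    have e2 : ∫ Y, F Y * (k2 (X + ev s - Y) - k2 (X - Y)) =
        (∫ Y, F Y * k2 (X + ev s - Y)) - ∫ Y, F Y * k2 (X - Y) := by
      rw [← integral_sub (i2 _ hXs0) (i2 _ hX0)]; congr 1; ext Y; ring
    rw [e1, e2]; ring
  have b1 : |∫ Y, (F (Y + ev s) - F Y) * k1 (X - Y)| ≤ M * s ^ γ * r ^ σ * J := by
    have hb : ∀ᵐ Y : EE n, ‖(F (Y + ev s) - F Y) * k1 (X - Y)‖ ≤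
        M * s ^ γ * r ^ σ * qq (lam + σ) 1 (X - Y) := by
      filter_upwards [ae_ne_sub X] with Y hY
      have hd := dd_pos hY
      by_cases hdr : dd (X - Y) < r
      · have hnr : ‖X - Y‖ < r := (norm_le_dd _).trans_lt hdr
        have hn0 : 0 < ‖X - Y‖ := norm_pos_iff.2 hY
        have hY2 : τ / 2 ≤ Y.2 := by
          have : |X.2 - Y.2| ≤ ‖X - Y‖ := norm_snd_le (X - Y)
          have := (abs_le.1 this).2
          linarith
        have hYn : ‖Y‖ ≤ R + 1 := by
          have : ‖Y‖ ≤ ‖X‖ + ‖X - Y‖ := by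
            have := norm_sub_le X (X - Y); simpa using this
          linarith
        have h1 := hM s hs hs1 Y hYn hY2
        have h2 : |k1 (X - Y)| ≤ r ^ σ * qq (lam + σ) 1 (X - Y) := by
          have hq : qq (lam + σ) 1 (X - Y) = ‖X - Y‖ ^ (-(lam + σ)) := by
            unfold qq; rw [Set.indicator_of_mem]; simp; linarith
          rw [abs_of_nonneg (sub_nonneg.2 (hk2le _ hY)), hq]
          calc k1 (X - Y) ≤ kk lam (X - Y) := by simp only [hk1]; linarith [hk20 (X - Y)]
            _ ≤ ‖X - Y‖ ^ (-lam) := Real.rpow_le_rpow_of_nonpos hn0 (norm_le_dd _) (by linarith)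
            _ = ‖X - Y‖ ^ σ * ‖X - Y‖ ^ (-(lam + σ)) := by
                rw [← Real.rpow_add hn0]; congr 1; ring
            _ ≤ r ^ σ * ‖X - Y‖ ^ (-(lam + σ)) := by gcongr
        rw [norm_mul, Real.norm_eq_abs, Real.norm_eq_abs]
        calc _ ≤ (M * s ^ γ) * (r ^ σ * qq (lam + σ) 1 (X - Y)) := by gcongr
          _ = _ := by ring
      · have : k1 (X - Y) = 0 := by
          simp only [hk1, hk2, kk]; rw [max_eq_left (not_lt.1 hdr), sub_self]
        rw [this, mul_zero, norm_zero]
        have := qq_nonneg (lam + σ) 1 (X - Y)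
        positivity
    have := norm_integral_le_of_norm_le (((qq_int hσl).comp_sub_left X).const_mul _) hb
    rw [Real.norm_eq_abs] at this
    rwa [integral_const_mul, integral_sub_left_eq_self (fun Z => qq (lam + σ) 1 Z)] at this
  have b2 : |∫ Y, F Y * (k2 (X + ev s - Y) - k2 (X - Y))| ≤ Λ * s / r * (2 * M') := by
    have hb : ∀ᵐ Y : EE n, ‖F Y * (k2 (X + ev s - Y) - k2 (X - Y))‖ ≤
        Λ * s / r * (F Y * kk lam (X + ev s - Y) + F Y * kk lam (X - Y)) := by
      filter_upwards [ae_ne_sub X, ae_ne_sub (X + ev s)] with Y hY hYs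
      rw [norm_mul, Real.norm_of_nonneg (hF0 _), Real.norm_eq_abs, ← mul_add, mul_left_comm]
      refine mul_le_mul_of_nonneg_left ?_ (hF0 _)
      set a := max (dd (X + ev s - Y)) r with ha
      set b := max (dd (X - Y)) r with hb
      have har : r ≤ a := le_max_right _ _
      have hbr : r ≤ b := le_max_right _ _
      have hl := ker_lip hl (hr0.trans_le har) (hr0.trans_le hbr)
      have hab : |a - b| ≤ s := by
        refine (abs_max_sub_max_le_abs _ _ _).trans ?_
        have := dd_ev (X - Y) s
        rw [abs_of_pos hs] at this
        rwa [add_sub_right_comm]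
      have h1 : a ^ (-lam) ≤ kk lam (X + ev s - Y) := hk2le _ hYs
      have h2 : b ^ (-lam) ≤ kk lam (X - Y) := hk2le _ hY
      have h3 : r * |a ^ (-lam) - b ^ (-lam)| ≤
          Λ * s * (kk lam (X + ev s - Y) + kk lam (X - Y)) := by
        calc _ ≤ a * |a ^ (-lam) - b ^ (-lam)| := by gcongr
          _ ≤ _ := hl
          _ ≤ _ := by
            have := kk_nonneg lam (X - Y)
            have := kk_nonneg lam (X + ev s - Y)
            gcongr
      rw [div_mul_eq_mul_div, le_div_iff₀ hr0, mul_comm]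
      exact h3
    have := norm_integral_le_of_norm_le (((hint _ hXs0).add (hint _ hX0)).const_mul _) hb
    rw [Real.norm_eq_abs] at this
    refine this.trans ?_
    simp only [Pi.add_apply]
    rw [integral_const_mul, integral_add (hint _ hXs0) (hint _ hX0), ← heq _ hXs0, ← heq _ hX0]
    have h1 := (le_abs_self _).trans (hM' _ (norm_add_ev hs hs1 hX) hXs0.le)
    have h2 := (le_abs_self _).trans (hM' _ (hX.trans (by linarith)) hX0.le)
    gcongr
    linarith
  set δ := min (γ + σ / 4) (3 / 4) with hδ
  have c1 : s ^ γ * r ^ σ ≤ c ^ σ * s ^ δ := by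
    rw [hr, Real.mul_rpow hc0.le (by positivity), ← Real.rpow_mul hs.le, mul_left_comm,
      ← Real.rpow_add hs]
    refine mul_le_mul_of_nonneg_left ?_ (by positivity)
    apply Real.rpow_le_rpow_of_exponent_ge hs hs1
    refine (min_le_left _ _).trans (le_of_eq (by ring))
  have c2 : s / r ≤ 1 / c * s ^ δ := by
    have : s / r = 1 / c * s ^ (3 / 4 : ℝ) := by
      have : s = s ^ (3 / 4 : ℝ) * s ^ (1 / 4 : ℝ) := by
        rw [← Real.rpow_add hs]; norm_num
      rw [hr]
      nth_rewrite 1 [this]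
      field_simp
    rw [this]
    refine mul_le_mul_of_nonneg_left ?_ (by positivity)
    exact Real.rpow_le_rpow_of_exponent_ge hs hs1 (min_le_right _ _)
  rw [key]
  refine (abs_add_le _ _).trans ((add_le_add b1 b2).trans ?_)
  calc M * s ^ γ * r ^ σ * J + Λ * s / r * (2 * M')
      = M * (s ^ γ * r ^ σ) * J + Λ * (s / r) * (2 * M') := by ring
    _ ≤ M * (c ^ σ * s ^ δ) * J + Λ * (1 / c * s ^ δ) * (2 * M') := by gcongr
    _ = _ := by ring

lemma hold_congr {w w' : EE n → ℝ} {γ : ℝ} (h : ∀ X : EE n, 0 < X.2 → w X = w' X)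
    (hw : Hold w γ) : Hold w' γ := by
  intro R τ hτ
  obtain ⟨M, hM0, hM⟩ := hw R τ hτ
  refine ⟨M, hM0, fun s hs hs1 X hX hXτ => ?_⟩
  rw [← h X (by linarith), ← h (X + ev s) (by rw [ev_snd]; linarith)]
  exact hM s hs hs1 X hX hXτ

lemma hold_zero {u : EE n → ℝ} (hu : ContinuousOn u {X | 0 ≤ X.2}) : Hold u 0 := by
  intro R τ hτ
  obtain ⟨M, hM0, hM⟩ := exists_upper hu (R + 1)
  refine ⟨2 * M, by positivity, fun s hs hs1 X hX hXτ => ?_⟩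
  have h1 := hM _ (norm_add_ev hs hs1 hX) (by rw [ev_snd]; linarith)
  have h2 := hM _ (hX.trans (by linarith)) (by linarith)
  rw [Real.rpow_zero, mul_one]
  refine (abs_sub _ _).trans ?_
  linarith

lemma hold_mono {u : EE n → ℝ} {γ δ : ℝ} (h : δ ≤ γ) (hu : Hold u γ) : Hold u δ := by
  intro R τ hτ
  obtain ⟨M, hM0, hM⟩ := hu R τ hτ
  refine ⟨M, hM0, fun s hs hs1 X hX hXτ => (hM s hs hs1 X hX hXτ).trans ?_⟩
  exact mul_le_mul_of_nonneg_left (Real.rpow_le_rpow_of_exponent_ge hs hs1 h) hM0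

def FF (p : ℝ) (w : EE n → ℝ) : EE n → ℝ := {X : EE n | 0 < X.2}.indicator (fun X => w X ^ p)

lemma FF_pos {p : ℝ} {w : EE n → ℝ} {X : EE n} (h : 0 < X.2) : FF p w X = w X ^ p :=
  Set.indicator_of_mem (s := {X : EE n | 0 < X.2}) h _

lemma FF_neg {p : ℝ} {w : EE n → ℝ} {X : EE n} (h : ¬ 0 < X.2) : FF p w X = 0 :=
  Set.indicator_of_notMem (s := {X : EE n | 0 < X.2}) h _

lemma isOpen_half : IsOpen {X : EE n | 0 < X.2} := isOpen_lt continuous_const continuous_snd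

structure Sys (n : ℕ) (lam κ θ : ℝ) (u v : EE n → ℝ) : Prop where
  hl : 0 < lam
  hl1 : lam < (n : ℝ) + 1
  hκ : 0 < κ
  hθ : 0 < θ
  cu : ContinuousOn u {X | 0 ≤ X.2}
  cv : ContinuousOn v {X | 0 ≤ X.2}
  pu : ∀ X : EE n, 0 ≤ X.2 → 0 < u X
  pv : ∀ X : EE n, 0 ≤ X.2 → 0 < v X
  iu : ∀ X : EE n, 0 < X.2 → Integrable (fun Y => FF κ v Y * kk lam (X - Y))
  eu : ∀ X : EE n, 0 < X.2 → u X = ∫ Y, FF κ v Y * kk lam (X - Y)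
  iv : ∀ X : EE n, 0 < X.2 → Integrable (fun Y => FF θ u Y * kk lam (X - Y))
  ev' : ∀ X : EE n, 0 < X.2 → v X = ∫ Y, FF θ u Y * kk lam (X - Y)
  Iu : Integrable (FF (θ + 1) u)

lemma FF_meas {p : ℝ} {w : EE n → ℝ} (hw : ContinuousOn w {X | 0 ≤ X.2})
    (hp : ∀ X : EE n, 0 ≤ X.2 → 0 < w X) : Measurable (FF p w) := by
  unfold FF
  rw [← Set.piecewise_eq_indicator]
  refine ContinuousOn.measurable_piecewise ?_ continuousOn_const isOpen_half.measurableSet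
  intro X hX
  have hX : 0 < X.2 := hX
  have h2 : ContinuousWithinAt w {X : EE n | 0 < X.2} X :=
    (hw X hX.le).mono (fun Y (hY : 0 < Y.2) => hY.le)
  exact h2.rpow_const (Or.inl (hp X hX.le).ne')

lemma FF_nonneg {p : ℝ} {w : EE n → ℝ}
    (hp : ∀ X : EE n, 0 ≤ X.2 → 0 < w X) (X : EE n) : 0 ≤ FF p w X :=
  Set.indicator_nonneg (fun X hX => Real.rpow_nonneg (hp X (le_of_lt hX)).le _) X

lemma FF_mul {p : ℝ} {w : EE n → ℝ}
    (hp : ∀ X : EE n, 0 ≤ X.2 → 0 < w X) (X : EE n) : FF p w X * w X = FF (p + 1) w X := by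
  by_cases h : 0 < X.2
  · rw [FF_pos h, FF_pos h, Real.rpow_add_one (hp X h.le).ne']
  · rw [FF_neg h, FF_neg h, zero_mul]

lemma ev_zero : (ev 0 : EE n) = 0 := rfl

def PP (lam κ θ : ℝ) (u v : EE n → ℝ) (s : ℝ) (p : EE n × EE n) : ℝ :=
  FF θ u p.1 * FF κ v p.2 * kk lam (p.1 + ev s - p.2)

variable {lam κ θ : ℝ} {u v : EE n → ℝ}

lemma young {a b θ : ℝ} (hθ : 0 < θ) (ha : 0 < a) (hb : 0 < b) :
    a ^ θ * (b - a) ≤ 1 / (θ + 1) * (b ^ (θ + 1) - a ^ (θ + 1)) := by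
  have h := one_add_mul_self_le_rpow_one_add (s := b / a - 1) (by
    have := div_pos hb ha; linarith) (p := θ + 1) (by linarith)
  rw [add_sub_cancel, Real.div_rpow hb.le ha.le] at h
  have hp : 0 < a ^ (θ + 1) := Real.rpow_pos_of_pos ha _
  rw [le_div_iff₀ hp] at h
  have e : a ^ (θ + 1) = a ^ θ * a := Real.rpow_add_one ha.ne' _
  have e2 : (1 + (θ + 1) * (b / a - 1)) * a ^ (θ + 1) =
      a ^ (θ + 1) + (θ + 1) * (a ^ θ * (b - a)) := by
    rw [e]; field_simp
  rw [e2] at h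
  rw [one_div, inv_mul_eq_div, le_div_iff₀ (by linarith)]
  linarith

lemma int4 {Ω : Type*} [MeasurableSpace Ω] {μ : Measure Ω} {a b c d : Ω → ℝ}
    (ha : Integrable a μ) (hb : Integrable b μ) (hc : Integrable c μ) (hd : Integrable d μ) :
    ∫ x, (a x - b x - c x + d x) ∂μ = (∫ x, a x ∂μ) - (∫ x, b x ∂μ) - (∫ x, c x ∂μ) + ∫ x, d x ∂μ := by
  have h1 : Integrable (fun x => a x - b x) μ := ha.sub hb
  have h2 : Integrable (fun x => a x - b x - c x) μ := h1.sub hc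
  rw [integral_add h2 hd, integral_sub h1 hc, integral_sub ha hb]

namespace Sys

lemma Fm (S : Sys n lam κ θ u v) : Measurable (FF κ v) := FF_meas S.cv S.pv
lemma Gm (S : Sys n lam κ θ u v) : Measurable (FF θ u) := FF_meas S.cu S.pu

lemma hold (S : Sys n lam κ θ u v) : Hold u (3 / 4) ∧ Hold v (3 / 4) := by
  set σ := ((n : ℝ) + 1 - lam) / 2 with hσ
  have hσ0 : 0 < σ := by have := S.hl1; rw [hσ]; linarith
  have hσl : lam + σ < (n : ℝ) + 1 := by have := S.hl1; rw [hσ]; linarith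
  have step : ∀ k : ℕ, Hold u (min (k * (σ / 4)) (3 / 4)) ∧ Hold v (min (k * (σ / 4)) (3 / 4)) := by
    intro k
    induction k with
    | zero =>
      have : min (((0 : ℕ) : ℝ) * (σ / 4)) (3 / 4) = 0 := by norm_num
      rw [this]; exact ⟨hold_zero S.cu, hold_zero S.cv⟩
    | succ k ih =>
      have hle : min (((k + 1 : ℕ) : ℝ) * (σ / 4)) (3 / 4) ≤
          min (min (k * (σ / 4)) (3 / 4) + σ / 4) (3 / 4) := by
        refine le_min ?_ (min_le_right _ _)
        rw [← min_add_add_right]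
        refine le_min ((min_le_left _ _).trans (le_of_eq (by push_cast; ring))) ?_
        exact (min_le_right _ _).trans (by linarith)
      refine ⟨hold_mono hle ?_, hold_mono hle ?_⟩
      · exact hold_conv S.hl hσ0 hσl (FF_nonneg S.pv) S.Fm S.cu S.iu S.eu
          (hold_congr (fun X hX => (FF_pos hX).symm) (hold_rpow S.cv S.pv ih.2))
      · exact hold_conv S.hl hσ0 hσl (FF_nonneg S.pu) S.Gm S.cv S.iv S.ev'
          (hold_congr (fun X hX => (FF_pos hX).symm) (hold_rpow S.cu S.pu ih.1))
  obtain ⟨k, hk⟩ := exists_nat_gt ((3 / 4) / (σ / 4))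
  rw [div_lt_iff₀ (by positivity)] at hk
  have := step k
  rwa [min_eq_right hk.le] at this

lemma PPm (S : Sys n lam κ θ u v) (s : ℝ) : Measurable (PP lam κ θ u v s) := by
  unfold PP
  have h1 := Measurable.comp (g := FF θ u) S.Gm (measurable_fst : Measurable (Prod.fst : EE n × EE n → EE n))
  have h2 := Measurable.comp (g := FF κ v) S.Fm (measurable_snd : Measurable (Prod.snd : EE n × EE n → EE n))
  have h3 : Measurable (fun p : EE n × EE n => kk lam (p.1 + ev s - p.2)) :=
    (kk_meas lam).comp ((measurable_fst.add_const _).sub measurable_snd)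
  exact (h1.mul h2).mul h3

lemma PP_nonneg (S : Sys n lam κ θ u v) (s : ℝ) (p) : 0 ≤ PP lam κ θ u v s p :=
  mul_nonneg (mul_nonneg (FF_nonneg S.pu _) (FF_nonneg S.pv _)) (kk_nonneg _ _)

lemma PP_slice (S : Sys n lam κ θ u v) {s : ℝ} (hs : 0 ≤ s) (X : EE n) :
    ∫ Y, PP lam κ θ u v s (X, Y) = FF θ u X * u (X + ev s) := by
  by_cases h : 0 < X.2
  · rw [S.eu _ (by rw [ev_snd]; linarith), ← integral_const_mul]
    congr 1; ext Y; simp only [PP]; ring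
  · simp [PP, FF_neg h]

lemma PP_slice' (S : Sys n lam κ θ u v) {s : ℝ} {Y : EE n} (hY : s < Y.2) :
    ∫ X, PP lam κ θ u v s (X, Y) = FF κ v Y * v (Y - ev s) := by
  rw [S.ev' _ (by simp [ev]; linarith), ← integral_const_mul]
  congr 1; ext X; simp only [PP]
  rw [kk_sub lam (X + ev s) Y, sub_add_eq_sub_sub_swap]; ring

lemma Gu_bound (S : Sys n lam κ θ u v) {s : ℝ} (hs : 0 ≤ s) (X : EE n) :
    FF θ u X * u (X + ev s) ≤ FF (θ + 1) u X + FF (θ + 1) u (X + ev s) := by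
  by_cases h : 0 < X.2
  · have h' : 0 < (X + ev s).2 := by rw [ev_snd]; linarith
    rw [FF_pos h, FF_pos h, FF_pos h']
    have a := S.pu X h.le
    have b := S.pu _ h'.le
    have hθ := S.hθ
    rcases le_total (u X) (u (X + ev s)) with hh | hh
    · have : u X ^ θ * u (X + ev s) ≤ u (X + ev s) ^ θ * u (X + ev s) := by gcongr
      rw [← Real.rpow_add_one b.ne'] at this
      have := Real.rpow_pos_of_pos a (θ + 1)
      linarith
    · have : u X ^ θ * u (X + ev s) ≤ u X ^ θ * u X := by gcongr
      rw [← Real.rpow_add_one a.ne'] at this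
      have := Real.rpow_pos_of_pos b (θ + 1)
      linarith
  · rw [FF_neg h, zero_mul]
    exact add_nonneg (FF_nonneg S.pu _) (FF_nonneg S.pu _)

lemma Gu_nonneg (S : Sys n lam κ θ u v) {s : ℝ} (hs : 0 ≤ s) (X : EE n) :
    0 ≤ FF θ u X * u (X + ev s) := by
  rw [← S.PP_slice hs]; exact integral_nonneg (fun _ => S.PP_nonneg _ _)

lemma Gu_int (S : Sys n lam κ θ u v) {s : ℝ} (hs : 0 ≤ s) :
    Integrable (fun X => FF θ u X * u (X + ev s)) := by
  refine (S.Iu.add (S.Iu.comp_add_right (ev s))).mono' ?_ ?_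
  · have : (fun X => FF θ u X * u (X + ev s)) = fun X => ∫ Y, PP lam κ θ u v s (X, Y) := by
      ext X; rw [S.PP_slice hs]
    rw [this]
    exact ((S.PPm s).stronglyMeasurable.integral_prod_right' (ν := volume)).aestronglyMeasurable
  · filter_upwards with X
    rw [Real.norm_of_nonneg (S.Gu_nonneg hs X)]
    exact S.Gu_bound hs X

lemma PP_int (S : Sys n lam κ θ u v) {s : ℝ} (hs : 0 ≤ s) :
    Integrable (PP lam κ θ u v s) (volume.prod volume) := by
  rw [integrable_prod_iff (S.PPm s).aestronglyMeasurable]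
  constructor
  · filter_upwards with X
    by_cases h : 0 < X.2
    · refine ((S.iu (X + ev s) (by rw [ev_snd]; linarith)).const_mul (FF θ u X)).congr ?_
      filter_upwards with Y
      simp only [PP]; ring
    · simp [PP, FF_neg h]
  · refine (S.Gu_int hs).congr ?_
    filter_upwards with X
    rw [← S.PP_slice hs]
    congr 1; ext Y; rw [Real.norm_of_nonneg (S.PP_nonneg _ _)]

lemma PP_total (S : Sys n lam κ θ u v) {s : ℝ} (hs : 0 ≤ s) :
    ∫ p, PP lam κ θ u v s p ∂(volume.prod volume) ≤ 2 * ∫ X, FF (θ + 1) u X := by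
  rw [integral_prod _ (S.PP_int hs)]
  have : ∀ X, ∫ Y, PP lam κ θ u v s (X, Y) = FF θ u X * u (X + ev s) := S.PP_slice hs
  simp_rw [this]
  refine (integral_mono (S.Gu_int hs) (S.Iu.add (S.Iu.comp_add_right (ev s)))
    (S.Gu_bound hs)).trans (le_of_eq ?_)
  simp only [Pi.add_apply]
  rw [integral_add S.Iu (S.Iu.comp_add_right (ev s)), integral_add_right_eq_self (FF (θ + 1) u)]
  ring

lemma Iv (S : Sys n lam κ θ u v) : Integrable (FF (κ + 1) v) := by
  refine (S.PP_int le_rfl).integral_prod_right.congr ?_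
  filter_upwards with Y
  by_cases h : 0 < Y.2
  · rw [S.PP_slice' h, ← FF_mul S.pv]; simp [ev_zero]
  · simp [PP, FF_neg h]

lemma swap (S : Sys n lam κ θ u v) : Sys n lam θ κ v u :=
  ⟨S.hl, S.hl1, S.hθ, S.hκ, S.cv, S.cu, S.pv, S.pu, S.iv, S.ev', S.iu, S.eu, S.Iv⟩

lemma J_le (S : Sys n lam κ θ u v) {ψ : EE n → ℝ} (hc : Continuous ψ) (h0 : ∀ X, 0 ≤ ψ X)
    (h1 : ∀ X, ψ X ≤ 1) {ρ s : ℝ} (hρ : 0 < ρ) (hψ : ∀ X, X.2 ≤ ρ → ψ X = 0) (hs : 0 ≤ s) :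
    (∫ X, ψ X * (FF θ u X * u (X + ev s))) - ∫ X, ψ X * (FF θ u X * u X) ≤
      - (1 / (θ + 1) * ∫ X, (ψ X - ψ (X - ev s)) * FF (θ + 1) u X) := by
  have hb : ∀ᵐ X : EE n, ‖ψ X‖ ≤ 1 := by
    filter_upwards with X; rw [Real.norm_of_nonneg (h0 X)]; exact h1 X
  have i1 := (S.Gu_int hs).bdd_mul (c := 1) hc.aestronglyMeasurable hb
  have i2 : Integrable (fun X => ψ X * (FF θ u X * u X)) := by
    simp_rw [FF_mul S.pu]
    exact S.Iu.bdd_mul (c := 1) hc.aestronglyMeasurable hb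
  have i3 := S.Iu.bdd_mul (c := 1) hc.aestronglyMeasurable hb
  have i4 := (S.Iu.comp_add_right (ev s)).bdd_mul (c := 1) hc.aestronglyMeasurable hb
  have e4 : ∫ X, ψ (X - ev s) * FF (θ + 1) u X = ∫ X, ψ X * FF (θ + 1) u (X + ev s) := by
    rw [← integral_add_right_eq_self (fun X => ψ (X - ev s) * FF (θ + 1) u X) (ev s)]
    simp
  have i5 : Integrable (fun X => ψ (X - ev s) * FF (θ + 1) u X) := by
    have := i4.comp_sub_right (ev s)
    simpa using this
  have e5 : ∫ X, (ψ X - ψ (X - ev s)) * FF (θ + 1) u X =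
      (∫ X, ψ X * FF (θ + 1) u X) - ∫ X, ψ X * FF (θ + 1) u (X + ev s) := by
    rw [← e4, ← integral_sub i3 i5]; congr 1; ext X; ring
  rw [e5, ← integral_sub i1 i2, ← integral_sub i3 i4, ← integral_const_mul, ← integral_neg]
  refine integral_mono (i1.sub i2) ((i3.sub i4).const_mul _).neg ?_
  intro X
  by_cases h : 0 < X.2
  · have h' : 0 < (X + ev s).2 := by rw [ev_snd]; linarith
    have := mul_le_mul_of_nonneg_left (young S.hθ (S.pu _ h.le) (S.pu _ h'.le)) (h0 X)
    simp only [Pi.neg_apply, Pi.sub_apply, FF_pos h, FF_pos h']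
    linarith
  · simp [FF_neg h, hψ X (by linarith)]

lemma main_ineq (S : Sys n lam κ θ u v) {ψ : EE n → ℝ} (hc : Continuous ψ) (h0 : ∀ X, 0 ≤ ψ X)
    (h1 : ∀ X, ψ X ≤ 1) {ρ s : ℝ} (hψ : ∀ X, X.2 ≤ ρ → ψ X = 0) (hs : 0 < s)
    (hsρ : s < ρ) :
    1 / (θ + 1) * (∫ X, (ψ X - ψ (X - ev s)) * FF (θ + 1) u X) +
    1 / (κ + 1) * (∫ X, (ψ X - ψ (X - ev s)) * FF (κ + 1) v X) ≤
    |∫ p : EE n × EE n, (ψ p.1 - ψ p.2) * (PP lam κ θ u v s p - PP lam κ θ u v 0 p)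
        ∂(volume.prod volume)| +
    |∫ Y, (ψ (Y + ev s) * FF κ v (Y + ev s) - ψ Y * FF κ v Y) * (v (Y + ev s) - v Y)| := by
  have hρ : 0 < ρ := hs.trans hsρ
  have J1 := S.J_le hc h0 h1 hρ hψ hs.le
  have J2 := S.swap.J_le hc h0 h1 hρ hψ hs.le
  have hb : ∀ᵐ X : EE n, ‖ψ X‖ ≤ 1 := by
    filter_upwards with X; rw [Real.norm_of_nonneg (h0 X)]; exact h1 X
  have hb1 : ∀ᵐ p : EE n × EE n ∂(volume.prod volume), ‖ψ p.1‖ ≤ 1 := by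
    filter_upwards with X; rw [Real.norm_of_nonneg (h0 _)]; exact h1 _
  have hb2 : ∀ᵐ p : EE n × EE n ∂(volume.prod volume), ‖ψ p.2‖ ≤ 1 := by
    filter_upwards with X; rw [Real.norm_of_nonneg (h0 _)]; exact h1 _
  have m1 : AEStronglyMeasurable (fun p : EE n × EE n => ψ p.1) (volume.prod volume) :=
    (hc.comp continuous_fst).aestronglyMeasurable
  have m2 : AEStronglyMeasurable (fun p : EE n × EE n => ψ p.2) (volume.prod volume) :=
    (hc.comp continuous_snd).aestronglyMeasurable
  have a1 := (S.PP_int hs.le).bdd_mul (c := 1) m1 hb1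
  have a2 := (S.PP_int le_rfl).bdd_mul (c := 1) m1 hb1
  have a3 := (S.PP_int hs.le).bdd_mul (c := 1) m2 hb2
  have a4 := (S.PP_int le_rfl).bdd_mul (c := 1) m2 hb2
  have E1 : ∫ p, ψ p.1 * PP lam κ θ u v s p ∂(volume.prod volume) =
      ∫ X, ψ X * (FF θ u X * u (X + ev s)) := by
    rw [integral_prod _ a1]
    congr 1; ext X; rw [← S.PP_slice hs.le, ← integral_const_mul]
  have E2 : ∫ p, ψ p.1 * PP lam κ θ u v 0 p ∂(volume.prod volume) =
      ∫ X, ψ X * (FF θ u X * u X) := by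
    rw [integral_prod _ a2]
    congr 1; ext X
    have := S.PP_slice le_rfl X
    rw [ev_zero, add_zero] at this
    rw [← this, ← integral_const_mul]
  have s3 : ∀ Y, ∫ X, ψ Y * PP lam κ θ u v s (X, Y) = ψ Y * (FF κ v Y * v (Y - ev s)) := by
    intro Y
    rw [integral_const_mul]
    by_cases h : s < Y.2
    · rw [S.PP_slice' h]
    · rw [hψ Y (by linarith)]; simp
  have s4 : ∀ Y, ∫ X, ψ Y * PP lam κ θ u v 0 (X, Y) = ψ Y * (FF κ v Y * v Y) := by
    intro Y
    rw [integral_const_mul]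
    by_cases h : 0 < Y.2
    · rw [S.PP_slice' h]; simp [ev_zero]
    · rw [hψ Y (by linarith)]; simp
  have E3 : ∫ p, ψ p.2 * PP lam κ θ u v s p ∂(volume.prod volume) =
      ∫ Y, ψ Y * (FF κ v Y * v (Y - ev s)) := by
    rw [integral_prod_symm _ a3]; simp_rw [s3]
  have E4 : ∫ p, ψ p.2 * PP lam κ θ u v 0 p ∂(volume.prod volume) =
      ∫ Y, ψ Y * (FF κ v Y * v Y) := by
    rw [integral_prod_symm _ a4]; simp_rw [s4]
  have i3 : Integrable (fun Y => ψ Y * (FF κ v Y * v (Y - ev s))) := by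
    refine a3.integral_prod_right.congr ?_
    filter_upwards with Y; exact s3 Y
  have i4 : Integrable (fun Y => ψ Y * (FF κ v Y * v Y)) := by
    refine a4.integral_prod_right.congr ?_
    filter_upwards with Y; exact s4 Y
  have i5 : Integrable (fun Y => ψ Y * (FF κ v Y * v (Y + ev s))) :=
    (S.swap.Gu_int hs.le).bdd_mul (c := 1) hc.aestronglyMeasurable hb
  have T1 : ∫ p : EE n × EE n, (ψ p.1 - ψ p.2) * (PP lam κ θ u v s p - PP lam κ θ u v 0 p)
        ∂(volume.prod volume) =
      (∫ X, ψ X * (FF θ u X * u (X + ev s))) - (∫ X, ψ X * (FF θ u X * u X)) -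
      (∫ Y, ψ Y * (FF κ v Y * v (Y - ev s))) + ∫ Y, ψ Y * (FF κ v Y * v Y) := by
    rw [← E1, ← E2, ← E3, ← E4, ← int4 a1 a2 a3 a4]
    congr 1; ext p; ring
  have i4s := i4.comp_add_right (ev s)
  have i3s := i3.comp_add_right (ev s)
  have T2 : ∫ Y, (ψ (Y + ev s) * FF κ v (Y + ev s) - ψ Y * FF κ v Y) * (v (Y + ev s) - v Y) =
      (∫ Y, ψ Y * (FF κ v Y * v Y)) - (∫ Y, ψ Y * (FF κ v Y * v (Y - ev s))) -
      (∫ Y, ψ Y * (FF κ v Y * v (Y + ev s))) + ∫ Y, ψ Y * (FF κ v Y * v Y) := by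
    nth_rewrite 1 [← integral_add_right_eq_self (fun Y => ψ Y * (FF κ v Y * v Y)) (ev s)]
    rw [← integral_add_right_eq_self (fun Y => ψ Y * (FF κ v Y * v (Y - ev s))) (ev s)]
    rw [← int4 i4s i3s i5 i4]
    congr 1; ext p; simp only [add_sub_cancel_right]; ring
  rw [T1, T2]
  have l1 := neg_abs_le ((∫ X, ψ X * (FF θ u X * u (X + ev s))) - (∫ X, ψ X * (FF θ u X * u X)) -
      (∫ Y, ψ Y * (FF κ v Y * v (Y - ev s))) + ∫ Y, ψ Y * (FF κ v Y * v Y))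
  have l2 := le_abs_self ((∫ Y, ψ Y * (FF κ v Y * v Y)) - (∫ Y, ψ Y * (FF κ v Y * v (Y - ev s))) -
      (∫ Y, ψ Y * (FF κ v Y * v (Y + ev s))) + ∫ Y, ψ Y * (FF κ v Y * v Y))
  linarith

end Sys

def cl (x : ℝ) : ℝ := max 0 (min 1 x)

lemma cl_nonneg (x : ℝ) : 0 ≤ cl x := le_max_left _ _
lemma cl_le (x : ℝ) : cl x ≤ 1 := max_le zero_le_one (min_le_left _ _)
lemma cl_mono {x y : ℝ} (h : x ≤ y) : cl x ≤ cl y := max_le_max_left _ (min_le_min_left _ h)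
lemma cl_zero {x : ℝ} (h : x ≤ 0) : cl x = 0 := max_eq_left ((min_le_right _ _).trans h)
lemma cl_one {x : ℝ} (h : 1 ≤ x) : cl x = 1 := by simp [cl, min_eq_left h]
lemma cl_id {x : ℝ} (h0 : 0 ≤ x) (h1 : x ≤ 1) : cl x = x := by simp [cl, h0, h1]
lemma cl_cont : Continuous cl := by unfold cl; fun_prop
lemma cl_lip (x y : ℝ) : |cl x - cl y| ≤ |x - y| := by
  unfold cl
  rw [max_comm, max_comm 0 (min 1 y), min_comm, min_comm 1 y]
  exact (abs_max_sub_max_le_abs _ _ _).trans (abs_min_sub_min_le_max _ _ _ _ |>.trans (by simp))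

def chi (ρ t : ℝ) : ℝ := cl ((t - ρ) / ρ)
def eta (R : ℝ) (X : EE n) : ℝ := cl (2 - ‖X‖ / R)
def psi (ρ R : ℝ) (X : EE n) : ℝ := chi ρ X.2 * eta R X

lemma chi_lip {ρ : ℝ} (hρ : 0 < ρ) (t z : ℝ) : |chi ρ t - chi ρ z| ≤ |t - z| / ρ := by
  refine (cl_lip _ _).trans (le_of_eq ?_)
  rw [← sub_div, abs_div, abs_of_pos hρ]; congr 2; ring

lemma eta_lip {R : ℝ} (hR : 0 < R) (X Y : EE n) : |eta R X - eta R Y| ≤ ‖X - Y‖ / R := by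
  refine (cl_lip _ _).trans ?_
  have : 2 - ‖X‖ / R - (2 - ‖Y‖ / R) = -((‖X‖ - ‖Y‖) / R) := by ring
  rw [this, abs_neg, abs_div, abs_of_pos hR]
  gcongr
  exact abs_norm_sub_norm_le _ _

lemma eta_one {R : ℝ} (hR : 1 ≤ R) {X : EE n} (h : ‖X‖ ≤ 1) : eta R X = 1 := by
  apply cl_one
  have : ‖X‖ / R ≤ 1 := (div_le_one (by linarith)).2 (by linarith)
  linarith

lemma eta_zero {R : ℝ} (hR : 0 < R) {X : EE n} (h : 2 * R ≤ ‖X‖) : eta R X = 0 := by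
  apply cl_zero
  have : 2 ≤ ‖X‖ / R := (le_div_iff₀ hR).2 h
  linarith

lemma chi_zero {ρ t : ℝ} (hρ : 0 < ρ) (h : t ≤ ρ) : chi ρ t = 0 :=
  cl_zero (div_nonpos_of_nonpos_of_nonneg (by linarith) hρ.le)

lemma chi_one {ρ t : ℝ} (hρ : 0 < ρ) (h : 2 * ρ ≤ t) : chi ρ t = 1 :=
  cl_one ((le_div_iff₀ hρ).2 (by linarith))

lemma psi_cont (ρ R : ℝ) : Continuous (psi ρ R : EE n → ℝ) := by
  unfold psi chi eta
  exact (cl_cont.comp (by fun_prop)).mul (cl_cont.comp (by fun_prop))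

lemma psi_nonneg (ρ R : ℝ) (X : EE n) : 0 ≤ psi ρ R X := mul_nonneg (cl_nonneg _) (cl_nonneg _)
lemma psi_le (ρ R : ℝ) (X : EE n) : psi ρ R X ≤ 1 :=
  mul_le_one₀ (cl_le _) (cl_nonneg _) (cl_le _)
lemma psi_zero {ρ R : ℝ} (hρ : 0 < ρ) (X : EE n) (h : X.2 ≤ ρ) : psi ρ R X = 0 := by
  rw [psi, chi_zero hρ h, zero_mul]
lemma psi_zero' {ρ R : ℝ} (hR : 0 < R) {X : EE n} (h : 2 * R ≤ ‖X‖) : psi ρ R X = 0 := by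
  rw [psi, eta_zero hR h, mul_zero]

lemma psi_lip {ρ R : ℝ} (hR : 0 < R) (X Y : EE n) :
    |psi ρ R X - psi ρ R Y| ≤ ‖X - Y‖ / R + |chi ρ X.2 - chi ρ Y.2| * eta R Y := by
  have e : psi ρ R X - psi ρ R Y =
      chi ρ X.2 * (eta R X - eta R Y) + (chi ρ X.2 - chi ρ Y.2) * eta R Y := by
    unfold psi; ring
  rw [e]
  refine (abs_add_le _ _).trans ?_
  have hc0 : 0 ≤ chi ρ X.2 := cl_nonneg _
  have he0 : 0 ≤ eta R Y := cl_nonneg _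
  rw [abs_mul, abs_mul, abs_of_nonneg hc0, abs_of_nonneg he0]
  have hc1 : chi ρ X.2 ≤ 1 := cl_le _
  have := mul_le_mul hc1 (eta_lip hR X Y) (abs_nonneg _) zero_le_one
  linarith

lemma chi_bd {ρ t z d σ : ℝ} (hρ : 0 < ρ) (hσ : 0 < σ) (hσ1 : σ < 1) (hd : 0 < d)
    (h : |t - z| ≤ d) :
    |chi ρ t - chi ρ z| ≤
      ((if t < 2 * ρ then 1 else 0) + (if z < 2 * ρ then 1 else 0)) * (d / ρ) ^ (1 - σ) := by
  have hp : 0 < d / ρ := div_pos hd hρ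
  have key : |chi ρ t - chi ρ z| ≤ (d / ρ) ^ (1 - σ) := by
    rcases le_total 1 (d / ρ) with h1 | h1
    · have a1 : |chi ρ t - chi ρ z| ≤ 1 := by
        have := cl_nonneg ((t - ρ) / ρ)
        have := cl_nonneg ((z - ρ) / ρ)
        have := cl_le ((t - ρ) / ρ)
        have := cl_le ((z - ρ) / ρ)
        unfold chi
        rw [abs_le]; constructor <;> linarith
      exact a1.trans (Real.one_le_rpow h1 (by linarith))
    · have a1 := (chi_lip hρ t z).trans (div_le_div_of_nonneg_right h hρ.le)
      refine a1.trans ?_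
      have := Real.rpow_le_rpow_of_exponent_ge hp h1 (show 1 - σ ≤ 1 by linarith)
      rwa [Real.rpow_one] at this
  have hq : 0 < (d / ρ) ^ (1 - σ) := Real.rpow_pos_of_pos hp _
  split_ifs with h1 h2 h2
  · linarith
  · linarith
  · linarith
  · rw [chi_one hρ (by linarith), chi_one hρ (by linarith)]; simp

lemma near_kernel {a b l σ : ℝ} (hl : 0 < l) (hσ : 0 < σ) (ha : 0 < a) (hb : 0 < b) :
    a ^ (-σ) * (a ^ (-l) + b ^ (-l)) ≤ 2 * a ^ (-(l + σ)) + b ^ (-(l + σ)) := by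
  have ea : a ^ (-(l + σ)) = a ^ (-σ) * a ^ (-l) := by rw [← Real.rpow_add ha]; ring_nf
  have eb : b ^ (-(l + σ)) = b ^ (-σ) * b ^ (-l) := by rw [← Real.rpow_add hb]; ring_nf
  have p1 := Real.rpow_pos_of_pos ha (-σ)
  have p2 := Real.rpow_pos_of_pos ha (-l)
  have p3 := Real.rpow_pos_of_pos hb (-σ)
  have p4 := Real.rpow_pos_of_pos hb (-l)
  rw [ea, eb]
  rcases le_total a b with h | h
  · have : b ^ (-l) ≤ a ^ (-l) := Real.rpow_le_rpow_of_nonpos ha h (by linarith)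
    nlinarith [mul_pos p3 p4]
  · have : a ^ (-σ) ≤ b ^ (-σ) := Real.rpow_le_rpow_of_nonpos hb h (by linarith)
    nlinarith [mul_pos p1 p2]

lemma qq_ge {a L : ℝ} (ha : 0 < a) {Z : EE n} (hZ : Z ≠ 0) (h : ‖Z‖ < L) :
    dd Z ^ (-a) ≤ qq a L Z := by
  unfold qq
  rw [Set.indicator_of_mem (by simpa using h)]
  exact Real.rpow_le_rpow_of_nonpos (norm_pos_iff.2 hZ) (norm_le_dd Z) (by linarith)

def SS (R ρ : ℝ) : Set (EE n) := Metric.closedBall 0 (3 * R) ×ˢ Set.Ioo 0 (2 * ρ)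

lemma SS_meas (R ρ : ℝ) : MeasurableSet (SS R ρ : Set (EE n)) :=
  measurableSet_closedBall.prod measurableSet_Ioo

lemma SS_vol (R : ℝ) {ρ : ℝ} (hρ : 0 < ρ) : (volume : Measure (EE n)).real (SS R ρ) =
    (volume : Measure (EuclideanSpace ℝ (Fin n))).real (Metric.closedBall 0 (3 * R)) * (2 * ρ) := by
  unfold SS
  rw [Measure.volume_eq_prod, measureReal_prod_prod, Real.volume_real_Ioo_of_le (by linarith)]
  simp

def ii (R ρ : ℝ) : EE n → ℝ := (SS R ρ).indicator (fun _ => 1)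

lemma ii_meas (R ρ : ℝ) : Measurable (ii R ρ : EE n → ℝ) :=
  measurable_const.indicator (SS_meas R ρ)

lemma ii_nonneg (R ρ : ℝ) (X : EE n) : 0 ≤ ii R ρ X :=
  Set.indicator_nonneg (fun _ _ => zero_le_one) _

lemma ii_int (R ρ : ℝ) : Integrable (ii R ρ : EE n → ℝ) := by
  unfold ii
  rw [integrable_indicator_iff (SS_meas R ρ)]
  apply integrableOn_const
  · refine ((Metric.isBounded_closedBall.prod (Metric.isBounded_Ioo _ _)).measure_lt_top).ne
  · simp

lemma ii_integral (R ρ : ℝ) : ∫ X : EE n, ii R ρ X = (volume : Measure (EE n)).real (SS R ρ) := by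
  unfold ii
  rw [integral_indicator (SS_meas R ρ)]; simp

lemma iq1 {a L : ℝ} (ha : a < (n : ℝ) + 1) (R ρ : ℝ) (h : EE n) :
    Integrable (fun p : EE n × EE n => ii R ρ p.1 * qq a L (p.1 + h - p.2)) (volume.prod volume) ∧
    ∫ p : EE n × EE n, ii R ρ p.1 * qq a L (p.1 + h - p.2) ∂(volume.prod volume) =
      (volume : Measure (EE n)).real (SS R ρ) * ∫ Z : EE n, qq a L Z := by
  have sl : ∀ X : EE n, ∫ Y : EE n, ii R ρ X * qq a L (X + h - Y) = ii R ρ X * ∫ Z : EE n, qq a L Z := by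
    intro X
    rw [integral_const_mul, integral_sub_left_eq_self (qq a L)]
  have hm : Measurable (fun p : EE n × EE n => ii R ρ p.1 * qq a L (p.1 + h - p.2)) :=
    ((ii_meas R ρ).comp measurable_fst).mul
      ((qq_meas a L).comp ((measurable_fst.add_const _).sub measurable_snd))
  have hi : Integrable (fun p : EE n × EE n => ii R ρ p.1 * qq a L (p.1 + h - p.2))
      (volume.prod volume) := by
    rw [integrable_prod_iff hm.aestronglyMeasurable]
    constructor
    · filter_upwards with X
      exact ((qq_int ha).comp_sub_left (X + h)).const_mul _
    · refine ((ii_int R ρ).mul_const (∫ Z : EE n, qq a L Z)).congr ?_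
      filter_upwards with X
      rw [← sl]
      congr 1; ext Y
      rw [Real.norm_of_nonneg (mul_nonneg (ii_nonneg _ _ _) (qq_nonneg _ _ _))]
  refine ⟨hi, ?_⟩
  rw [integral_prod _ hi]
  simp_rw [sl]
  rw [integral_mul_const, ii_integral]

lemma iq2 {a L : ℝ} (ha : a < (n : ℝ) + 1) (R ρ : ℝ) (h : EE n) :
    Integrable (fun p : EE n × EE n => ii R ρ p.2 * qq a L (p.1 + h - p.2)) (volume.prod volume) ∧
    ∫ p : EE n × EE n, ii R ρ p.2 * qq a L (p.1 + h - p.2) ∂(volume.prod volume) =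
      (volume : Measure (EE n)).real (SS R ρ) * ∫ Z : EE n, qq a L Z := by
  have sl : ∀ Y : EE n, ∫ X : EE n, ii R ρ Y * qq a L (X + h - Y) = ii R ρ Y * ∫ Z : EE n, qq a L Z := by
    intro X
    rw [integral_const_mul]
    simp_rw [add_sub_assoc]
    rw [integral_add_right_eq_self (qq a L)]
  have hm : Measurable (fun p : EE n × EE n => ii R ρ p.2 * qq a L (p.1 + h - p.2)) :=
    ((ii_meas R ρ).comp measurable_snd).mul
      ((qq_meas a L).comp ((measurable_fst.add_const _).sub measurable_snd))
  have hi : Integrable (fun p : EE n × EE n => ii R ρ p.2 * qq a L (p.1 + h - p.2))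
      (volume.prod volume) := by
    rw [integrable_prod_iff' hm.aestronglyMeasurable]
    constructor
    · filter_upwards with Y
      simp_rw [add_sub_assoc]
      exact ((qq_int ha).comp_add_right (h - Y)).const_mul _
    · refine ((ii_int R ρ).mul_const (∫ Z : EE n, qq a L Z)).congr ?_
      filter_upwards with X
      rw [← sl]
      congr 1; ext Y
      rw [Real.norm_of_nonneg (mul_nonneg (ii_nonneg _ _ _) (qq_nonneg _ _ _))]
  refine ⟨hi, ?_⟩
  rw [integral_prod_symm _ hi]
  simp_rw [sl]
  rw [integral_mul_const, ii_integral]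

lemma ae_ne_prod (h : EE n) : ∀ᵐ p : EE n × EE n ∂(volume.prod volume), p.1 + h - p.2 ≠ 0 := by
  rw [Measure.ae_prod_iff_ae_ae]
  · filter_upwards with X
    exact ae_ne_sub (X + h)
  · exact (isClosed_eq (by fun_prop) continuous_const).measurableSet.compl

lemma FF_le {w : EE n → ℝ} (p : ℝ) (hw : ContinuousOn w {X | 0 ≤ X.2})
    (hp : ∀ X : EE n, 0 ≤ X.2 → 0 < w X) (R : ℝ) :
    ∃ M, 0 < M ∧ ∀ X : EE n, ‖X‖ ≤ R → FF p w X ≤ M := by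
  have hc : ContinuousOn (fun X => w X ^ p) {X : EE n | 0 ≤ X.2} :=
    fun X hX => (hw X hX).rpow_const (Or.inl (hp X hX).ne')
  obtain ⟨M, hM0, hM⟩ := exists_upper hc R
  refine ⟨M, hM0, fun X hX => ?_⟩
  by_cases h : 0 < X.2
  · rw [FF_pos h]; exact (le_abs_self _).trans (hM X hX h.le)
  · rw [FF_neg h]; exact hM0.le

namespace Sys

lemma T1_point (S : Sys n lam κ θ u v) {σ R ρ s M : ℝ} (hσ : 0 < σ) (hσ1 : σ < 1)
    (hR : 1 ≤ R) (hρ : 0 < ρ) (hs : 0 < s) (hs1 : s ≤ 1) (hM : 0 < M)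
    (hG : ∀ X : EE n, ‖X‖ ≤ 3 * R → FF θ u X ≤ M) (hF : ∀ X : EE n, ‖X‖ ≤ 3 * R → FF κ v X ≤ M)
    (X Y : EE n) (h1 : X - Y ≠ 0) (h2 : X + ev s - Y ≠ 0) :
    |(psi ρ R X - psi ρ R Y) * (PP lam κ θ u v s (X, Y) - PP lam κ θ u v 0 (X, Y))| ≤
      max 1 lam * s * (1 / R * (PP lam κ θ u v 0 (X, Y) + PP lam κ θ u v s (X, Y)) +
        M ^ 2 * ρ ^ (σ - 1) * ((ii R ρ X + ii R ρ Y) *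
          (2 * qq (lam + σ) (6 * R + 2) (X - Y) + qq (lam + σ) (6 * R + 2) (X + ev s - Y)))) := by
  have hR0 : 0 < R := by linarith
  set g := FF θ u X with hg
  set f := FF κ v Y with hf
  have g0 : 0 ≤ g := FF_nonneg S.pu X
  have f0 : 0 ≤ f := FF_nonneg S.pv Y
  set a := dd (X - Y) with ha
  set b := dd (X + ev s - Y) with hb
  have a0 : 0 < a := dd_pos h1
  have b0 : 0 < b := dd_pos h2
  have e0 : PP lam κ θ u v 0 (X, Y) = g * f * a ^ (-lam) := by
    simp only [PP, kk, ev_zero, add_zero]; rfl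
  have es : PP lam κ θ u v s (X, Y) = g * f * b ^ (-lam) := rfl
  have hab : |a - b| ≤ s := by
    have := dd_ev (X - Y) s
    rw [abs_of_pos hs, ← add_sub_right_comm] at this
    rw [abs_sub_comm]; exact this
  set K := a ^ (-lam) + b ^ (-lam) with hK
  have hK0 : 0 < K := add_pos (Real.rpow_pos_of_pos a0 _) (Real.rpow_pos_of_pos b0 _)
  set Λ := max 1 lam with hΛ
  have hΛ0 : 0 < Λ := by positivity
  have kl : |b ^ (-lam) - a ^ (-lam)| ≤ Λ * s * K / a := by
    rw [le_div_iff₀ a0, abs_sub_comm, mul_comm]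
    refine (ker_lip S.hl a0 b0).trans ?_
    gcongr
  set Q := 2 * qq (lam + σ) (6 * R + 2) (X - Y) + qq (lam + σ) (6 * R + 2) (X + ev s - Y) with hQ
  have Q0 : 0 ≤ Q := by
    have := qq_nonneg (lam + σ) (6 * R + 2) (X - Y)
    have := qq_nonneg (lam + σ) (6 * R + 2) (X + ev s - Y)
    linarith
  set I := ii R ρ X + ii R ρ Y with hI
  have I0 : 0 ≤ I := add_nonneg (ii_nonneg _ _ _) (ii_nonneg _ _ _)
  have r0 : 0 < ρ ^ (σ - 1) := Real.rpow_pos_of_pos hρ _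
  have key : |psi ρ R X - psi ρ R Y| * (g * f) * (K / a) ≤
      1 / R * (g * f * K) + M ^ 2 * ρ ^ (σ - 1) * (I * Q) := by
    have far : |psi ρ R X - psi ρ R Y| ≤ a / R → |psi ρ R X - psi ρ R Y| * (g * f) * (K / a) ≤
      1 / R * (g * f * K) + M ^ 2 * ρ ^ (σ - 1) * (I * Q) := by
      intro h
      have t1 : |psi ρ R X - psi ρ R Y| * (g * f) * (K / a) ≤ a / R * (g * f) * (K / a) := by
        gcongr
      have t2 : a / R * (g * f) * (K / a) = 1 / R * (g * f * K) := by field_simp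
      have t3 : 0 ≤ M ^ 2 * ρ ^ (σ - 1) * (I * Q) := by positivity
      linarith
    have hna : ‖X - Y‖ ≤ a := norm_le_dd _
    have pl := psi_lip (ρ := ρ) hR0 X Y
    by_cases hX : 0 < X.2
    swap
    · have : g = 0 := FF_neg hX
      rw [this]; simp; positivity
    by_cases hY : 0 < Y.2
    swap
    · have : f = 0 := FF_neg hY
      rw [this]; simp; positivity
    rcases le_or_gt (2 * R) ‖Y‖ with hY2 | hY2
    · apply far
      rw [eta_zero hR0 hY2] at pl
      have : ‖X - Y‖ / R ≤ a / R := by gcongr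
      linarith
    rcases le_or_gt R ‖X - Y‖ with hd | hd
    · apply far
      have : 1 ≤ a / R := (one_le_div hR0).2 (hd.trans hna)
      refine le_trans ?_ this
      have := psi_nonneg ρ R X
      have := psi_nonneg ρ R Y
      have := psi_le ρ R X
      have := psi_le ρ R Y
      rw [abs_le]; constructor <;> linarith
    have hY3 : ‖Y‖ ≤ 3 * R := by linarith
    have hX3 : ‖X‖ ≤ 3 * R := by
      have : ‖X‖ ≤ ‖X - Y‖ + ‖Y‖ := by simpa using norm_add_le (X - Y) Y
      linarith
    have iX : ii R ρ X = if X.2 < 2 * ρ then 1 else 0 := by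
      have : X.1 ∈ Metric.closedBall (0 : EuclideanSpace ℝ (Fin n)) (3 * R) := by
        simpa using (norm_fst_le X).trans hX3
      simp only [ii, SS, Set.indicator, Set.mem_prod, this, Set.mem_Ioo, hX, true_and]
    have iY : ii R ρ Y = if Y.2 < 2 * ρ then 1 else 0 := by
      have : Y.1 ∈ Metric.closedBall (0 : EuclideanSpace ℝ (Fin n)) (3 * R) := by
        simpa using (norm_fst_le Y).trans hY3
      simp only [ii, SS, Set.indicator, Set.mem_prod, this, Set.mem_Ioo, hY, true_and]
    have cb := chi_bd (ρ := ρ) (t := X.2) (z := Y.2) hρ hσ hσ1 a0 (by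
      have := norm_snd_le (X - Y)
      rw [Real.norm_eq_abs] at this
      exact this.trans hna)
    rw [← iX, ← iY, ← hI] at cb
    have he1 : eta R Y ≤ 1 := cl_le _
    have pl2 : |psi ρ R X - psi ρ R Y| ≤ a / R + I * (a / ρ) ^ (1 - σ) := by
      have t1 : ‖X - Y‖ / R ≤ a / R := by gcongr
      have t2 := mul_le_of_le_one_right (abs_nonneg (chi ρ X.2 - chi ρ Y.2)) he1
      linarith
    have q1 : a ^ (-(lam + σ)) ≤ qq (lam + σ) (6 * R + 2) (X - Y) :=
      qq_ge (by linarith [S.hl]) h1 (by linarith)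
    have q2 : b ^ (-(lam + σ)) ≤ qq (lam + σ) (6 * R + 2) (X + ev s - Y) := by
      refine qq_ge (by linarith [S.hl]) h2 ?_
      rw [add_sub_right_comm]
      exact (norm_add_ev hs hs1 hd.le).trans_lt (by linarith)
    have nk := near_kernel S.hl hσ a0 b0
    have hgf : g * f ≤ M ^ 2 := by
      rw [sq]; exact mul_le_mul (hG X hX3) (hF Y hY3) f0 hM.le
    have ea : (a / ρ) ^ (1 - σ) * (1 / a) = ρ ^ (σ - 1) * a ^ (-σ) := by
      rw [Real.div_rpow a0.le hρ.le, show (1 : ℝ) - σ = -(σ - 1) by ring, Real.rpow_neg hρ.le,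
        show -(σ - 1) = -σ + 1 by ring, Real.rpow_add_one a0.ne']
      field_simp
    calc |psi ρ R X - psi ρ R Y| * (g * f) * (K / a)
        ≤ (a / R + I * (a / ρ) ^ (1 - σ)) * (g * f) * (K / a) := by gcongr
      _ = 1 / R * (g * f * K) + (I * (g * f)) * K * ((a / ρ) ^ (1 - σ) * (1 / a)) := by
          field_simp
      _ = 1 / R * (g * f * K) + (g * f) * ρ ^ (σ - 1) * (I * (a ^ (-σ) * K)) := by
          rw [ea]; ring
      _ ≤ 1 / R * (g * f * K) + M ^ 2 * ρ ^ (σ - 1) * (I * Q) := by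
          have : a ^ (-σ) * K ≤ Q := by rw [hQ]; linarith
          have p0 : 0 ≤ a ^ (-σ) * K := mul_nonneg (Real.rpow_nonneg a0.le _) hK0.le
          gcongr
  rw [e0, es, abs_mul, ← mul_sub, abs_mul, abs_of_nonneg (mul_nonneg g0 f0)]
  calc |psi ρ R X - psi ρ R Y| * (g * f * |b ^ (-lam) - a ^ (-lam)|)
      ≤ |psi ρ R X - psi ρ R Y| * (g * f * (Λ * s * K / a)) := by gcongr
    _ = Λ * s * (|psi ρ R X - psi ρ R Y| * (g * f) * (K / a)) := by ring
    _ ≤ Λ * s * (1 / R * (g * f * K) + M ^ 2 * ρ ^ (σ - 1) * (I * Q)) := by gcongr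
    _ = _ := by rw [hK]; ring

lemma T1_bound (S : Sys n lam κ θ u v) : ∃ σ : ℝ, 0 < σ ∧ ∀ R : ℝ, 1 ≤ R → ∃ C : ℝ, 0 ≤ C ∧
    ∀ ρ s : ℝ, 0 < ρ → 0 < s → s ≤ 1 →
    |∫ p : EE n × EE n, (psi ρ R p.1 - psi ρ R p.2) * (PP lam κ θ u v s p - PP lam κ θ u v 0 p)
        ∂(volume.prod volume)| ≤
      max 1 lam * s * (4 * (∫ X, FF (θ + 1) u X) / R + C * ρ ^ σ) := by
  set σ := min (((n : ℝ) + 1 - lam) / 2) (1 / 2) with hσ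
  have hl1 := S.hl1
  have hl := S.hl
  have hσ0 : 0 < σ := lt_min (by linarith) (by norm_num)
  have hσ1 : σ < 1 := (min_le_right _ _).trans_lt (by norm_num)
  have hσl : lam + σ < (n : ℝ) + 1 := by
    have : σ ≤ ((n : ℝ) + 1 - lam) / 2 := min_le_left _ _
    linarith
  refine ⟨σ, hσ0, fun R hR => ?_⟩
  obtain ⟨M1, hM1, hG⟩ := FF_le θ S.cu S.pu (3 * R)
  obtain ⟨M2, hM2, hF⟩ := FF_le κ S.cv S.pv (3 * R)
  set M := max M1 M2 with hM
  have hM0 : 0 < M := lt_max_of_lt_left hM1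
  set W := (volume : Measure (EuclideanSpace ℝ (Fin n))).real (Metric.closedBall 0 (3 * R)) with hW
  set q : EE n → ℝ := qq (lam + σ) (6 * R + 2) with hq
  set B := ∫ Z, q Z with hB
  have B0 : 0 ≤ B := integral_nonneg (qq_nonneg _ _)
  refine ⟨M ^ 2 * (12 * W * B), by positivity, fun ρ s hρ hs hs1 => ?_⟩
  have hR0 : 0 < R := by linarith
  have i1 := S.PP_int le_rfl
  have i2 := S.PP_int hs.le
  have j1 := iq1 (L := 6 * R + 2) hσl R ρ 0
  have j2 := iq1 (L := 6 * R + 2) hσl R ρ (ev s)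
  have j3 := iq2 (L := 6 * R + 2) hσl R ρ 0
  have j4 := iq2 (L := 6 * R + 2) hσl R ρ (ev s)
  rw [SS_vol R hρ, ← hW] at j1 j2 j3 j4
  rw [← hq, ← hB] at j1 j2 j3 j4
  simp only [add_zero] at j1 j3
  have hint : Integrable (fun p : EE n × EE n => max 1 lam * s * (1 / R *
      (PP lam κ θ u v 0 p + PP lam κ θ u v s p) + M ^ 2 * ρ ^ (σ - 1) *
      (2 * (ii R ρ p.1 * q (p.1 - p.2)) + ii R ρ p.1 * q (p.1 + ev s - p.2) +
       (2 * (ii R ρ p.2 * q (p.1 - p.2)) + ii R ρ p.2 * q (p.1 + ev s - p.2)))))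
      (volume.prod volume) :=
    (((i1.add i2).const_mul _).add ((((j1.1.const_mul 2).add j2.1).add
      ((j3.1.const_mul 2).add j4.1)).const_mul _)).const_mul _
  have hle : ∀ᵐ p : EE n × EE n ∂(volume.prod volume),
      ‖(psi ρ R p.1 - psi ρ R p.2) * (PP lam κ θ u v s p - PP lam κ θ u v 0 p)‖ ≤
      max 1 lam * s * (1 / R *
      (PP lam κ θ u v 0 p + PP lam κ θ u v s p) + M ^ 2 * ρ ^ (σ - 1) *
      (2 * (ii R ρ p.1 * q (p.1 - p.2)) + ii R ρ p.1 * q (p.1 + ev s - p.2) +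
       (2 * (ii R ρ p.2 * q (p.1 - p.2)) + ii R ρ p.2 * q (p.1 + ev s - p.2)))) := by
    filter_upwards [ae_ne_prod (0 : EE n), ae_ne_prod (ev s : EE n)] with p hp1 hp2
    rw [add_zero] at hp1
    have := S.T1_point hσ0 hσ1 hR hρ hs hs1 hM0
      (fun X hX => (hG X hX).trans (le_max_left _ _))
      (fun X hX => (hF X hX).trans (le_max_right _ _)) p.1 p.2 hp1 hp2
    rw [Real.norm_eq_abs]
    refine this.trans (le_of_eq ?_)
    rw [← hq]; ring
  have := norm_integral_le_of_norm_le hint hle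
  rw [Real.norm_eq_abs] at this
  refine this.trans ?_
  rw [integral_const_mul]
  have k1 : Integrable (fun p : EE n × EE n => 2 * (ii R ρ p.1 * q (p.1 - p.2)) + ii R ρ p.1 * q (p.1 + ev s - p.2)) (volume.prod volume) :=
    (j1.1.const_mul 2).add j2.1
  have k2 : Integrable (fun p : EE n × EE n => 2 * (ii R ρ p.2 * q (p.1 - p.2)) + ii R ρ p.2 * q (p.1 + ev s - p.2)) (volume.prod volume) :=
    (j3.1.const_mul 2).add j4.1
  have k0 : Integrable (fun p : EE n × EE n => 1 / R * (PP lam κ θ u v 0 p + PP lam κ θ u v s p))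
      (volume.prod volume) := (i1.add i2).const_mul _
  have k3 : Integrable (fun p : EE n × EE n => M ^ 2 * ρ ^ (σ - 1) *
      (2 * (ii R ρ p.1 * q (p.1 - p.2)) + ii R ρ p.1 * q (p.1 + ev s - p.2) +
       (2 * (ii R ρ p.2 * q (p.1 - p.2)) + ii R ρ p.2 * q (p.1 + ev s - p.2))))
      (volume.prod volume) := (k1.add k2).const_mul _
  rw [integral_add k0 k3]
  rw [integral_const_mul, integral_const_mul, integral_add i1 i2, integral_add k1 k2,
    integral_add (j1.1.const_mul 2) j2.1, integral_add (j3.1.const_mul 2) j4.1,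
    integral_const_mul, integral_const_mul, j1.2, j2.2, j3.2, j4.2]
  have t1 := S.PP_total le_rfl
  have t2 := S.PP_total hs.le
  have er : ρ ^ σ = ρ ^ (σ - 1) * ρ := by
    rw [← Real.rpow_add_one hρ.ne']; ring_nf
  apply mul_le_mul_of_nonneg_left _ (by positivity)
  apply add_le_add
  · rw [one_div, inv_mul_eq_div]; gcongr; linarith
  · rw [er]; apply le_of_eq; ring

end Sys

namespace Sys

lemma T2_bound (S : Sys n lam κ θ u v) {R ρ : ℝ} (hR : 1 ≤ R) (hρ : 0 < ρ) (hρ1 : ρ ≤ 1) :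
    ∃ C : ℝ, 0 ≤ C ∧ ∀ s : ℝ, 0 < s → s ≤ ρ / 2 →
    |∫ Y, (psi ρ R (Y + ev s) * FF κ v (Y + ev s) - psi ρ R Y * FF κ v Y) *
        (v (Y + ev s) - v Y)| ≤ C * (s * s ^ (1 / 2 : ℝ)) := by
  have hR0 : 0 < R := by linarith
  obtain ⟨M1, hM10, hM1⟩ := S.hold.2 (2 * R + 1) (ρ / 2) (by linarith)
  have hfF : Hold (FF κ v) (3 / 4) :=
    hold_congr (fun X hX => (FF_pos hX).symm) (hold_rpow S.cv S.pv S.hold.2)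
  obtain ⟨M2, hM20, hM2⟩ := hfF (2 * R + 1) (ρ / 2) (by linarith)
  obtain ⟨M3, hM30, hM3⟩ := FF_le κ S.cv S.pv (2 * R + 1)
  set C := (M2 + M3 * (1 / R + 1 / ρ)) * M1 with hC
  have C0 : 0 ≤ C := by positivity
  set W := (volume : Measure (EE n)).real (Metric.closedBall 0 (2 * R + 1)) with hW
  refine ⟨C * W, by positivity, fun s hs hsρ => ?_⟩
  have hs1 : s ≤ 1 := by linarith
  have hint : Integrable ((Metric.closedBall (0 : EE n) (2 * R + 1)).indicator
      (fun _ => C * (s * s ^ (1 / 2 : ℝ)))) := by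
    rw [integrable_indicator_iff measurableSet_closedBall]
    apply integrableOn_const
    · exact Metric.isBounded_closedBall.measure_lt_top.ne
    · exact enorm_ne_top
  have hle : ∀ᵐ Y : EE n, ‖(psi ρ R (Y + ev s) * FF κ v (Y + ev s) - psi ρ R Y * FF κ v Y) *
        (v (Y + ev s) - v Y)‖ ≤ (Metric.closedBall (0 : EE n) (2 * R + 1)).indicator
      (fun _ => C * (s * s ^ (1 / 2 : ℝ))) Y := by
    filter_upwards with Y
    have c0 : 0 ≤ C * (s * s ^ (1 / 2 : ℝ)) := by positivity
    have n0 : 0 ≤ (Metric.closedBall (0 : EE n) (2 * R + 1)).indicator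
      (fun _ => C * (s * s ^ (1 / 2 : ℝ))) Y := Set.indicator_nonneg (fun _ _ => c0) _
    by_cases h1 : ‖Y‖ ≤ 2 * R + 1
    swap
    · have e2 : 2 * R ≤ ‖Y + ev s‖ := by
        have := norm_sub_le (Y + ev s) (ev s)
        rw [add_sub_cancel_right, norm_ev, abs_of_pos hs] at this
        linarith
      rw [psi_zero' hR0 e2, psi_zero' hR0 (by linarith)]
      simpa using n0
    by_cases h2 : ρ / 2 ≤ Y.2
    swap
    · rw [psi_zero hρ Y (by linarith), psi_zero hρ (Y + ev s) (by rw [ev_snd]; linarith)]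
      simpa using n0
    rw [Set.indicator_of_mem (by simpa using h1), Real.norm_eq_abs, abs_mul]
    have a1 := hM1 s hs hs1 Y h1 h2
    have a2 := hM2 s hs hs1 Y h1 h2
    have a3 := hM3 Y h1
    have a3' : 0 ≤ FF κ v Y := FF_nonneg S.pv Y
    have a4 : |psi ρ R (Y + ev s) - psi ρ R Y| ≤ (1 / R + 1 / ρ) * s := by
      have := psi_lip (ρ := ρ) hR0 (Y + ev s) Y
      have c := chi_lip hρ (Y + ev s).2 Y.2
      have e : eta R Y ≤ 1 := cl_le _
      have := mul_le_of_le_one_right (abs_nonneg (chi ρ (Y + ev s).2 - chi ρ Y.2)) e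
      rw [ev_snd, add_sub_cancel_left, abs_of_pos hs] at c
      rw [ev_snd] at *
      rw [add_sub_cancel_left, norm_ev, abs_of_pos hs] at *
      have e : (1 / R + 1 / ρ) * s = s / R + s / ρ := by ring
      rw [e]; linarith
    have p1 : |psi ρ R (Y + ev s)| ≤ 1 := by
      rw [abs_of_nonneg (psi_nonneg _ _ _)]; exact psi_le _ _ _
    set r := s ^ (3 / 4 : ℝ) with hr
    have r0 : 0 < r := Real.rpow_pos_of_pos hs _
    have sr : s ≤ r := by
      have := Real.rpow_le_rpow_of_exponent_ge hs hs1 (show (3 / 4 : ℝ) ≤ 1 by norm_num)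
      rwa [Real.rpow_one] at this
    have err : r * r = s * s ^ (1 / 2 : ℝ) := by
      rw [hr, ← Real.rpow_add hs, ← Real.rpow_one_add' hs.le (by norm_num)]; norm_num
    have b1 : |psi ρ R (Y + ev s) * FF κ v (Y + ev s) - psi ρ R Y * FF κ v Y| ≤
        (M2 + M3 * (1 / R + 1 / ρ)) * r := by
      have e : psi ρ R (Y + ev s) * FF κ v (Y + ev s) - psi ρ R Y * FF κ v Y =
        psi ρ R (Y + ev s) * (FF κ v (Y + ev s) - FF κ v Y) +
        FF κ v Y * (psi ρ R (Y + ev s) - psi ρ R Y) := by ring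
      rw [e]
      refine (abs_add_le _ _).trans ?_
      rw [abs_mul, abs_mul, abs_of_nonneg a3']
      have x1 := mul_le_mul p1 a2 (abs_nonneg _) zero_le_one
      have x2 := mul_le_mul a3 a4 (abs_nonneg _) hM30.le
      have x3 : M3 * ((1 / R + 1 / ρ) * s) ≤ M3 * ((1 / R + 1 / ρ) * r) := by gcongr
      linarith
    refine (mul_le_mul b1 a1 (abs_nonneg _) (by positivity)).trans (le_of_eq ?_)
    rw [← err, hC]; ring
  have := norm_integral_le_of_norm_le hint hle
  rw [Real.norm_eq_abs] at this
  refine this.trans (le_of_eq ?_)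
  rw [integral_indicator measurableSet_closedBall, setIntegral_const, smul_eq_mul, ← hW]; ring

end Sys

lemma psi_shift_int {g : EE n → ℝ} (hg : Integrable g) (ρ R s : ℝ) :
    Integrable (fun X => (psi ρ R X - psi ρ R (X - ev s)) * g X) := by
  refine hg.bdd_mul (c := 1) ?_ ?_
  · exact ((psi_cont ρ R).sub ((psi_cont ρ R).comp (by fun_prop))).aestronglyMeasurable
  · filter_upwards with X
    have := psi_nonneg ρ R X
    have := psi_nonneg ρ R (X - ev s)
    have := psi_le ρ R X
    have := psi_le ρ R (X - ev s)
    rw [Real.norm_eq_abs, abs_le]; constructor <;> linarith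

lemma psi_shift_ge {ρ R s : ℝ} (hR : 0 < R) (hρ : 0 < ρ) (hs : 0 < s) (X : EE n) :
    (chi ρ X.2 - chi ρ (X.2 - s)) * eta R X - s / R ≤ psi ρ R X - psi ρ R (X - ev s) := by
  have e : psi ρ R X - psi ρ R (X - ev s) = (chi ρ X.2 - chi ρ (X.2 - s)) * eta R X +
      chi ρ (X.2 - s) * (eta R X - eta R (X - ev s)) := by
    unfold psi
    have : (X - ev s).2 = X.2 - s := rfl
    rw [this]; ring
  have h := eta_lip hR X (X - ev s)
  rw [_root_.sub_sub_cancel, norm_ev, abs_of_pos hs] at h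
  have c0 : 0 ≤ chi ρ (X.2 - s) := cl_nonneg _
  have c1 : chi ρ (X.2 - s) ≤ 1 := cl_le _
  have h2 : |chi ρ (X.2 - s) * (eta R X - eta R (X - ev s))| ≤ s / R := by
    rw [abs_mul, abs_of_nonneg c0]
    have := mul_le_of_le_one_left (abs_nonneg (eta R X - eta R (X - ev s))) c1
    linarith
  have := (abs_le.1 h2).1
  linarith

lemma chi_mono {ρ t z : ℝ} (hρ : 0 < ρ) (h : t ≤ z) : chi ρ t ≤ chi ρ z :=
  cl_mono (by gcongr)

lemma lhs_ge {g : EE n → ℝ} (hg : Integrable g) (g0 : ∀ X, 0 ≤ g X) {ρ R s c : ℝ}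
    (hR : 1 ≤ R) (hρ : 0 < ρ) (hρ1 : ρ ≤ 1 / 2) (hs : 0 < s) (hsρ : s ≤ ρ / 2) (hc : 0 ≤ c)
    (hgc : ∀ X : EE n, ‖X‖ ≤ 1 → 0 < X.2 → c ≤ g X) :
    s * (c * (volume : Measure (EuclideanSpace ℝ (Fin n))).real (Metric.closedBall 0 1) / 2) -
      s / R * (∫ X, g X) ≤ ∫ X, (psi ρ R X - psi ρ R (X - ev s)) * g X := by
  have hR0 : 0 < R := by linarith
  set Q : Set (EE n) := Metric.closedBall 0 1 ×ˢ Set.Ioo (ρ + s) (2 * ρ) with hQ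
  have Qm : MeasurableSet Q := measurableSet_closedBall.prod measurableSet_Ioo
  set W := (volume : Measure (EuclideanSpace ℝ (Fin n))).real (Metric.closedBall 0 1) with hW
  have Qv : (volume : Measure (EE n)).real Q = W * (ρ - s) := by
    rw [hQ, Measure.volume_eq_prod, measureReal_prod_prod, Real.volume_real_Ioo_of_le (by linarith)]
    rw [hW]; ring
  have hint : Integrable (Q.indicator (fun _ => s / ρ * c)) := by
    rw [integrable_indicator_iff Qm]
    apply integrableOn_const
    · exact ((Metric.isBounded_closedBall.prod (Metric.isBounded_Ioo _ _)).measure_lt_top).ne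
    · exact enorm_ne_top
  have W0 : 0 ≤ W := measureReal_nonneg
  calc s * (c * W / 2) - s / R * (∫ X, g X)
      ≤ (∫ X, Q.indicator (fun _ => s / ρ * c) X) - s / R * (∫ X, g X) := by
        rw [integral_indicator Qm, setIntegral_const, smul_eq_mul, Qv]
        have : s * (c * W / 2) ≤ W * (ρ - s) * (s / ρ * c) := by
          have e : W * (ρ - s) * (s / ρ * c) = s * (c * W * ((ρ - s) / ρ)) := by ring
          have e2 : 1 / 2 ≤ (ρ - s) / ρ := by rw [le_div_iff₀ hρ]; linarith
          have : c * W * (1 / 2) ≤ c * W * ((ρ - s) / ρ) := by gcongr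
          rw [e]; gcongr; linarith
        linarith
    _ = ∫ X, (Q.indicator (fun _ => s / ρ * c) X - s / R * g X) := by
        rw [integral_sub hint (hg.const_mul _), integral_const_mul]
    _ ≤ _ := by
        refine integral_mono (hint.sub (hg.const_mul _)) (psi_shift_int hg ρ R s) ?_
        intro X
        have h1 := mul_le_mul_of_nonneg_right (psi_shift_ge hR0 hρ hs X) (g0 X)
        refine le_trans ?_ h1
        have cm := chi_mono hρ (show X.2 - s ≤ X.2 by linarith)
        have e0 : 0 ≤ eta R X := cl_nonneg _
        have : Q.indicator (fun _ => s / ρ * c) X ≤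
            (chi ρ X.2 - chi ρ (X.2 - s)) * eta R X * g X := by
          by_cases hX : X ∈ Q
          · rw [Set.indicator_of_mem hX]
            obtain ⟨hx1, hx2, hx3⟩ := hX
            have n1 : ‖X‖ ≤ 1 := by
              rw [Prod.norm_def]
              refine max_le (by simpa using hx1) ?_
              rw [Real.norm_eq_abs, abs_of_pos (by linarith)]; linarith
            have d1 : chi ρ X.2 - chi ρ (X.2 - s) = s / ρ := by
              unfold chi
              rw [cl_id, cl_id]
              · ring
              · exact div_nonneg (by linarith) hρ.le
              · rw [div_le_one hρ]; linarith
              · exact div_nonneg (by linarith) hρ.le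
              · rw [div_le_one hρ]; linarith
            rw [d1, eta_one hR n1, mul_one]
            have := hgc X n1 (by linarith)
            gcongr
          · rw [Set.indicator_of_notMem hX]
            exact mul_nonneg (mul_nonneg (by linarith) e0) (g0 X)
        linarith

namespace Sys

theorem contra (S : Sys n lam κ θ u v) : False := by
  have hθ := S.hθ
  have hκ := S.hκ
  set A := ∫ X, FF (θ + 1) u X with hA
  set B := ∫ X, FF (κ + 1) v X with hB
  have A0 : 0 ≤ A := integral_nonneg (FF_nonneg S.pu)
  have B0 : 0 ≤ B := integral_nonneg (FF_nonneg S.pv)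
  set W := (volume : Measure (EuclideanSpace ℝ (Fin n))).real (Metric.closedBall 0 1) with hW
  have W0 : 0 < W := by
    rw [hW, measureReal_def]
    exact ENNReal.toReal_pos (Metric.measure_closedBall_pos _ _ one_pos).ne'
      Metric.isBounded_closedBall.measure_lt_top.ne
  obtain ⟨c0, hc0, hcu⟩ := exists_lower S.cu S.pu 1
  set c := c0 ^ (θ + 1) with hc
  have c_pos : 0 < c := Real.rpow_pos_of_pos hc0 _
  have hgc : ∀ X : EE n, ‖X‖ ≤ 1 → 0 < X.2 → c ≤ FF (θ + 1) u X := by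
    intro X h1 h2
    rw [FF_pos h2]
    exact Real.rpow_le_rpow hc0.le (hcu X h1 h2.le) (by linarith)
  set m := 1 / (θ + 1) * (c * W / 2) with hm
  have m0 : 0 < m := by positivity
  set Λ := max 1 lam with hΛ
  have Λ0 : 0 < Λ := by positivity
  obtain ⟨σ, hσ, hT1⟩ := S.T1_bound
  set D := A + B + Λ * (4 * A) with hD
  have D0 : 0 ≤ D := by positivity
  set R := max 1 (4 * D / m) with hR
  have hR1 : 1 ≤ R := le_max_left _ _
  have hR0 : 0 < R := by linarith
  have RD : D / R ≤ m / 4 := by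
    have : 4 * D / m ≤ R := le_max_right _ _
    rw [div_le_iff₀ m0] at this
    rw [div_le_iff₀ hR0]; linarith
  obtain ⟨C, hC0, hT1⟩ := hT1 R hR1
  obtain ⟨ρ, hρ, hρ1, hρC⟩ : ∃ ρ : ℝ, 0 < ρ ∧ ρ ≤ 1 / 2 ∧ Λ * C * ρ ^ σ ≤ m / 4 := by
    have ht : Filter.Tendsto (fun x : ℝ => Λ * C * x ^ σ) (nhdsWithin 0 (Set.Ioi 0)) (nhds 0) := by
      have : ContinuousAt (fun x : ℝ => Λ * C * x ^ σ) 0 :=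
        continuousAt_const.mul (Real.continuousAt_rpow_const _ _ (Or.inr hσ.le))
      have h := this.tendsto
      simp only [Real.zero_rpow hσ.ne', mul_zero] at h
      exact h.mono_left nhdsWithin_le_nhds
    have e1 := ht.eventually (ge_mem_nhds (show (0 : ℝ) < m / 4 by linarith))
    have e2 : ∀ᶠ x : ℝ in nhdsWithin 0 (Set.Ioi 0), x ≤ 1 / 2 :=
      nhdsWithin_le_nhds (ge_mem_nhds (by norm_num))
    obtain ⟨x, hx, hx2, hx3⟩ := (e1.and (e2.and self_mem_nhdsWithin)).exists
    exact ⟨x, hx3, hx2, hx⟩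
  obtain ⟨C2, hC20, hT2⟩ := S.T2_bound hR1 hρ (by linarith)
  obtain ⟨s, hs, hsρ, hsC⟩ : ∃ s : ℝ, 0 < s ∧ s ≤ ρ / 2 ∧ C2 * s ^ (1 / 2 : ℝ) ≤ m / 4 := by
    have ht : Filter.Tendsto (fun x : ℝ => C2 * x ^ (1 / 2 : ℝ)) (nhdsWithin 0 (Set.Ioi 0)) (nhds 0) := by
      have : ContinuousAt (fun x : ℝ => C2 * x ^ (1 / 2 : ℝ)) 0 :=
        continuousAt_const.mul (Real.continuousAt_rpow_const _ _ (Or.inr (by norm_num)))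
      have h := this.tendsto
      simp only [Real.zero_rpow (show (1 / 2 : ℝ) ≠ 0 by norm_num), mul_zero] at h
      exact h.mono_left nhdsWithin_le_nhds
    have e1 := ht.eventually (ge_mem_nhds (show (0 : ℝ) < m / 4 by linarith))
    have e2 : ∀ᶠ x : ℝ in nhdsWithin 0 (Set.Ioi 0), x ≤ ρ / 2 :=
      nhdsWithin_le_nhds (ge_mem_nhds (by linarith))
    obtain ⟨x, hx, hx2, hx3⟩ := (e1.and (e2.and self_mem_nhdsWithin)).exists
    exact ⟨x, hx3, hx2, hx⟩
  have M := S.main_ineq (psi_cont ρ R) (psi_nonneg ρ R) (psi_le ρ R) (psi_zero hρ) hs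
    (by linarith)
  have t1 := hT1 ρ s hρ hs (by linarith)
  have t2 := hT2 s hs hsρ
  have l1 := lhs_ge S.Iu (FF_nonneg S.pu) hR1 hρ hρ1 hs hsρ c_pos.le hgc
  have l2 := lhs_ge S.Iv (FF_nonneg S.pv) hR1 hρ hρ1 hs hsρ le_rfl
    (fun X _ _ => FF_nonneg S.pv X)
  rw [← hA, ← hW] at l1
  rw [← hB] at l2
  have q1 : 1 / (θ + 1) ≤ 1 := by rw [div_le_one (by linarith)]; linarith
  have q1' : 0 < 1 / (θ + 1) := by positivity
  have q2 : 1 / (κ + 1) ≤ 1 := by rw [div_le_one (by linarith)]; linarith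
  have q2' : 0 < 1 / (κ + 1) := by positivity
  have m1 := mul_le_mul_of_nonneg_left l1 q1'.le
  have m2 := mul_le_mul_of_nonneg_left l2 q2'.le
  have z1 : 1 / (θ + 1) * (s / R * A) ≤ s / R * A := mul_le_of_le_one_left (by positivity) q1
  have z2 : 1 / (κ + 1) * (s / R * B) ≤ s / R * B := mul_le_of_le_one_left (by positivity) q2
  have fin : s * m - s / R * A - s / R * B ≤
      Λ * s * (4 * A / R + C * ρ ^ σ) + C2 * (s * s ^ (1 / 2 : ℝ)) := by
    have e1 : 1 / (θ + 1) * (s * (c * W / 2) - s / R * A) = s * m - 1 / (θ + 1) * (s / R * A) := by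
      rw [hm]; ring
    rw [e1] at m1
    simp only [zero_mul, zero_div, mul_zero, zero_sub, mul_neg] at m2
    linarith
  have fin2 : s * m ≤ s * (D / R + Λ * C * ρ ^ σ + C2 * s ^ (1 / 2 : ℝ)) := by
    have : s * (D / R + Λ * C * ρ ^ σ + C2 * s ^ (1 / 2 : ℝ)) = s / R * A + s / R * B +
      (Λ * s * (4 * A / R + C * ρ ^ σ) + C2 * (s * s ^ (1 / 2 : ℝ))) := by
      rw [hD]; ring
    linarith
  have := le_of_mul_le_mul_left fin2 hs
  linarith

end Sys

lemma hsDist_eq (X Y : EE n) : hsDist X Y = dd (X - Y) := rfl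

lemma hsDist_comm (X Y : EE n) : hsDist X Y = hsDist Y X := by
  rw [hsDist_eq, hsDist_eq, ← dd_neg, neg_sub]

lemma exp_nonpos {α β : ℝ} (hl : 0 < lam) (hκ : 0 < κ)
    (cu : ContinuousOn u {X | 0 ≤ X.2}) (cv : ContinuousOn v {X | 0 ≤ X.2})
    (pv : ∀ X : EE n, 0 ≤ X.2 → 0 < v X)
    (h : ∀ X ∈ upperHalf n, ENNReal.ofReal (u X) = ENNReal.ofReal (X.2 ^ (-α)) *
            ∫⁻ Y in upperHalf n, ENNReal.ofReal (v Y ^ κ) * ENNReal.ofReal (Y.2 ^ (-β)) *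
                ENNReal.ofReal (hsDist X Y) ^ (-lam)) : α ≤ 0 := by
  by_contra hα
  push Not at hα
  obtain ⟨M, hM0, hM⟩ := exists_upper cu 1
  obtain ⟨m, hm0, hm⟩ := exists_lower cv pv 2
  set B : Set (EE n) := Metric.closedBall 0 1 ×ˢ Set.Icc 1 2 with hB
  have Bm : MeasurableSet B := measurableSet_closedBall.prod measurableSet_Icc
  have Bsub : B ⊆ upperHalf n := by
    rintro Y ⟨_, h1, _⟩
    show 0 < Y.2
    linarith
  have Bv : volume B ≠ 0 := by
    rw [hB, Measure.volume_eq_prod, Measure.prod_prod]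
    refine mul_ne_zero (Metric.measure_closedBall_pos _ _ one_pos).ne' ?_
    rw [Real.volume_Icc]; norm_num
  set k : ℝ≥0∞ := ENNReal.ofReal (m ^ κ) * ENNReal.ofReal (2 ^ (-|β|)) *
    ENNReal.ofReal 3 ^ (-lam) with hk
  have k0 : k ≠ 0 := by
    refine mul_ne_zero (mul_ne_zero ?_ ?_) ?_
    · exact (ENNReal.ofReal_pos.2 (Real.rpow_pos_of_pos hm0 _)).ne'
    · exact (ENNReal.ofReal_pos.2 (by positivity)).ne'
    · rw [ENNReal.ofReal_rpow_of_pos (by norm_num)]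
      exact (ENNReal.ofReal_pos.2 (by positivity)).ne'
  set δ := k * volume B with hδ
  have δ0 : δ ≠ 0 := mul_ne_zero k0 Bv
  have low : ∀ t : ℝ, 0 < t → t ≤ 1 → ENNReal.ofReal (t ^ (-α)) * δ ≤ ENNReal.ofReal M := by
    intro t ht ht1
    have hX : ((0, t) : EE n) ∈ upperHalf n := ht
    have nX : ‖((0, t) : EE n)‖ ≤ 1 := by
      rw [Prod.norm_def]; simp [abs_of_pos ht, ht1]
    have h1 := h _ hX
    have h2 : ENNReal.ofReal (u (0, t)) ≤ ENNReal.ofReal M :=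
      ENNReal.ofReal_le_ofReal ((le_abs_self _).trans (hM _ nX ht.le))
    rw [h1] at h2
    refine le_trans ?_ h2
    show ENNReal.ofReal (t ^ (-α)) * δ ≤ ENNReal.ofReal (t ^ (-α)) * _
    gcongr
    rw [hδ, ← setLIntegral_const]
    refine le_trans ?_ (lintegral_mono_set Bsub)
    refine setLIntegral_mono' Bm ?_
    rintro Y ⟨hy1, hy2, hy3⟩
    have hy1' : ‖Y.1‖ ≤ 1 := by simpa using hy1
    have nY : ‖Y‖ ≤ 2 := by
      rw [Prod.norm_def]
      refine max_le (by linarith) ?_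
      rw [Real.norm_eq_abs, abs_of_pos (by linarith)]; exact hy3
    have a1 : m ^ κ ≤ v Y ^ κ := Real.rpow_le_rpow hm0.le (hm Y nY (by linarith)) hκ.le
    have a2 : (2 : ℝ) ^ (-|β|) ≤ Y.2 ^ (-β) := by
      have b1 : (2 : ℝ) ^ (-|β|) ≤ Y.2 ^ (-|β|) :=
        Real.rpow_le_rpow_of_nonpos (by linarith) hy3 (by simp)
      exact b1.trans (Real.rpow_le_rpow_of_exponent_le hy2 (neg_le_neg (le_abs_self β)))
    have a3 : hsDist ((0, t) : EE n) Y ≤ 3 := by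
      unfold hsDist
      refine Real.sqrt_le_iff.2 ⟨by norm_num, ?_⟩
      simp only [zero_sub, norm_neg]
      nlinarith [norm_nonneg Y.1]
    have a4 : ENNReal.ofReal 3 ^ (-lam) ≤ ENNReal.ofReal (hsDist ((0, t) : EE n) Y) ^ (-lam) := by
      rw [ENNReal.rpow_neg, ENNReal.rpow_neg]
      gcongr
    rw [hk]
    gcongr
  set d := (min δ 1).toReal with hd
  have dtop : min δ 1 ≠ ⊤ := ne_top_of_le_ne_top one_ne_top (min_le_right _ _)
  have d0 : 0 < d := ENNReal.toReal_pos (by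
    rcases min_choice δ 1 with h | h <;> rw [h]
    · exact δ0
    · exact one_ne_zero) dtop
  have low2 : ∀ t : ℝ, 0 < t → t ≤ 1 → t ^ (-α) * d ≤ M := by
    intro t ht ht1
    have p : 0 ≤ t ^ (-α) := Real.rpow_nonneg ht.le _
    have : ENNReal.ofReal (t ^ (-α) * d) ≤ ENNReal.ofReal M := by
      rw [ENNReal.ofReal_mul p, hd, ENNReal.ofReal_toReal dtop]
      exact le_trans (by gcongr; exact min_le_left _ _) (low t ht ht1)
    exact (ENNReal.ofReal_le_ofReal_iff hM0.le).1 this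
  set x := max 1 ((M + 1) / d) with hx
  have x1 : 1 ≤ x := le_max_left _ _
  have hxM : M + 1 ≤ x * d := (div_le_iff₀ d0).1 (le_max_right _ _)
  have := low2 (x ^ (-(1 / α))) (Real.rpow_pos_of_pos (by linarith) _)
    (Real.rpow_le_one_of_one_le_of_nonpos x1 (by
      have : 0 < 1 / α := by positivity
      linarith))
  rw [← Real.rpow_mul (by linarith), show -(1 / α) * -α = 1 by field_simp, Real.rpow_one] at this
  linarith

lemma conv_int (hv : ContinuousOn v {X | 0 ≤ X.2}) (pv : ∀ X : EE n, 0 ≤ X.2 → 0 < v X)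
    (pu : ∀ X : EE n, 0 ≤ X.2 → 0 < u X)
    (h : ∀ X ∈ upperHalf n, ENNReal.ofReal (u X) = ENNReal.ofReal (X.2 ^ (-(0 : ℝ))) *
            ∫⁻ Y in upperHalf n, ENNReal.ofReal (v Y ^ κ) * ENNReal.ofReal (Y.2 ^ (-(0 : ℝ))) *
                ENNReal.ofReal (hsDist X Y) ^ (-lam)) (X : EE n) (hX : 0 < X.2) :
    Integrable (fun Y => FF κ v Y * kk lam (X - Y)) ∧ u X = ∫ Y, FF κ v Y * kk lam (X - Y) := by
  have e := h X hX
  simp only [neg_zero, Real.rpow_zero, ENNReal.ofReal_one, one_mul, mul_one] at e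
  have hm : MeasurableSet (upperHalf n) := isOpen_half.measurableSet
  have e2 : ∫⁻ Y in upperHalf n, ENNReal.ofReal (v Y ^ κ) * ENNReal.ofReal (hsDist X Y) ^ (-lam) =
      ∫⁻ Y, ENNReal.ofReal (FF κ v Y * kk lam (X - Y)) := by
    rw [← lintegral_indicator hm]
    refine lintegral_congr_ae ?_
    filter_upwards [ae_ne_sub X] with Y hY
    by_cases hy : 0 < Y.2
    · rw [Set.indicator_of_mem (show Y ∈ upperHalf n from hy), FF_pos hy,
        ENNReal.ofReal_mul (Real.rpow_nonneg (pv Y hy.le).le _), hsDist_eq,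
        ENNReal.ofReal_rpow_of_pos (dd_pos hY)]
      rfl
    · rw [Set.indicator_of_notMem (show Y ∉ upperHalf n from hy), FF_neg hy]; simp
  rw [e2] at e
  have n0 : ∀ Y, 0 ≤ FF κ v Y * kk lam (X - Y) :=
    fun Y => mul_nonneg (FF_nonneg pv Y) (kk_nonneg _ _)
  have ms : AEStronglyMeasurable (fun Y => FF κ v Y * kk lam (X - Y)) volume :=
    ((FF_meas hv pv).mul ((kk_meas lam).comp (measurable_const.sub measurable_id))).aestronglyMeasurable
  refine ⟨⟨ms, ?_⟩, ?_⟩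
  · rw [hasFiniteIntegral_iff_ofReal (Filter.Eventually.of_forall n0), ← e]
    exact ENNReal.ofReal_lt_top
  · rw [integral_eq_lintegral_of_nonneg_ae (Filter.Eventually.of_forall n0) ms, ← e,
      ENNReal.toReal_ofReal (pu X hX.le).le]

lemma conv_fin (hu : ContinuousOn u {X | 0 ≤ X.2}) (pu : ∀ X : EE n, 0 ≤ X.2 → 0 < u X)
    (h : (∫⁻ X in upperHalf n, ENNReal.ofReal (u X ^ (θ + 1))) < ⊤) :
    Integrable (FF (θ + 1) u) := by
  have hm : MeasurableSet (upperHalf n) := isOpen_half.measurableSet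
  refine ⟨(FF_meas hu pu).aestronglyMeasurable, ?_⟩
  rw [hasFiniteIntegral_iff_ofReal (Filter.Eventually.of_forall (FF_nonneg pu))]
  rw [← lintegral_indicator hm] at h
  refine lt_of_le_of_lt (le_of_eq ?_) h
  congr 1; ext Y
  by_cases hy : 0 < Y.2
  · rw [Set.indicator_of_mem (show Y ∈ upperHalf n from hy), FF_pos hy]
  · rw [Set.indicator_of_notMem (show Y ∉ upperHalf n from hy), FF_neg hy]; simp

end HS

/-- Nonexistence of positive solutions of the Euler–Lagrange system in the
subcritical case. -/
theorem nonexistence_subcritical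
    (n : ℕ) (hn : 1 ≤ n) (lam κ θ α β : ℝ)
    (hlam0 : 0 < lam) (hlam1 : lam < (n : ℝ) + 1)
    (hκ : 0 < κ) (hθ : 0 < θ) (hκθ : 1 ≤ κ * θ)
    (hα : α < 1 / (θ + 1)) (hβ : β < 1 / (κ + 1)) (hαβ : 0 ≤ α + β)
    (hla : 0 < lam + 2 * α) (hlb : 0 < lam + 2 * β)
    (hκle : κ ≤ (2 * ((n : ℝ) + 1) - lam - 2 * β) / (lam + 2 * β))
    (hθle : θ ≤ (2 * ((n : ℝ) + 1) - lam - 2 * α) / (lam + 2 * α))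
    (hsub : (α + β + lam) / ((n : ℝ) + 1) < 1 / (θ + 1) + 1 / (κ + 1)) :
    ¬ ∃ u v : EuclideanSpace ℝ (Fin n) × ℝ → ℝ,
        ContinuousOn u {X | 0 ≤ X.2} ∧ ContinuousOn v {X | 0 ≤ X.2} ∧
        (∀ X : EuclideanSpace ℝ (Fin n) × ℝ, 0 ≤ X.2 → 0 < u X) ∧
        (∀ X : EuclideanSpace ℝ (Fin n) × ℝ, 0 ≤ X.2 → 0 < v X) ∧
        (∫⁻ X in upperHalf n, ENNReal.ofReal (u X ^ (θ + 1))) < ⊤ ∧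
        (∀ X ∈ upperHalf n,
          ENNReal.ofReal (u X) = ENNReal.ofReal (X.2 ^ (-α)) *
            ∫⁻ Y in upperHalf n,
              ENNReal.ofReal (v Y ^ κ) * ENNReal.ofReal (Y.2 ^ (-β)) *
                ENNReal.ofReal (hsDist X Y) ^ (-lam)) ∧
        (∀ Y ∈ upperHalf n,
          ENNReal.ofReal (v Y) = ENNReal.ofReal (Y.2 ^ (-β)) *
            ∫⁻ X in upperHalf n,
              ENNReal.ofReal (u X ^ θ) * ENNReal.ofReal (X.2 ^ (-α)) *
                ENNReal.ofReal (hsDist X Y) ^ (-lam)) := by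
  rintro ⟨u, v, cu, cv, pu, pv, hfin, hu, hv⟩
  have hv' : ∀ Y ∈ upperHalf n,
          ENNReal.ofReal (v Y) = ENNReal.ofReal (Y.2 ^ (-β)) *
            ∫⁻ X in upperHalf n,
              ENNReal.ofReal (u X ^ θ) * ENNReal.ofReal (X.2 ^ (-α)) *
                ENNReal.ofReal (hsDist Y X) ^ (-lam) := by
    intro Y hY
    rw [hv Y hY]
    simp_rw [HS.hsDist_comm _ Y]
  have a0 : α ≤ 0 := HS.exp_nonpos hlam0 hκ cu cv pv hu
  have b0 : β ≤ 0 := HS.exp_nonpos hlam0 hθ cv cu pu hv'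
  obtain rfl : α = 0 := by linarith
  obtain rfl : β = 0 := by linarith
  have c1 := HS.conv_int cv pv pu hu
  have c2 := HS.conv_int cu pu pv hv'
  exact HS.Sys.contra (lam := lam) (κ := κ) (θ := θ) (u := u) (v := v)
    ⟨hlam0, hlam1, hκ, hθ, cu, cv, pu, pv, fun X hX => (c1 X hX).1, fun X hX => (c1 X hX).2,
      fun X hX => (c2 X hX).1, fun X hX => (c2 X hX).2, HS.conv_fin cu pu hfin⟩
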